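/- Let S be a finite tree that is neither a star nor a path. Then the inducibility of S is at most 1 - 10^{-35}; that is, limsup_{n→∞} max{ d(S,T) : T is an n-vertex tree } ≤ 1 - 10^{-35}. -/

import Mathlib

open SimpleGraph Filter

/-- The degree of a vertex, as the cardinality of its neighbour set. -/
noncomputable def ndeg {V : Type*} (G : SimpleGraph V) (v : V) : ℕ :=
  (G.neighborSet v).ncard

/-- `Z_k(G)`: the number of `k`-vertex subtrees (connected subgraphs) of `G`. -/
noncomputable def subtreeCount {V : Type*} [Fintype V] (G : SimpleGraph V) (k : ℕ) : ℕ :=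
  {s : Finset V | s.card = k ∧ (G.induce (s : Set V)).Connected}.ncard

/-- The number of embeddings (subtrees isomorphic to `S`) of a tree `S` in `G`,
counted among `k`-vertex subtrees. -/
noncomputable def embCount {V W : Type*} [Fintype V] (G : SimpleGraph V)
    (S : SimpleGraph W) (k : ℕ) : ℕ :=
  {s : Finset V | s.card = k ∧ Nonempty ((G.induce (s : Set V)) ≃g S)}.ncard

/-- The density `d(S,T)`: the number of embeddings of the `|S|`-vertex tree `S` in `T`
divided by the number of `|S|`-vertex subtrees of `T` (`0` if `T` has fewer vertices). -/
noncomputable def density {V W : Type*} [Fintype V] [Fintype W]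
    (S : SimpleGraph W) (T : SimpleGraph V) : ℝ :=
  (embCount T S (Fintype.card W) : ℝ) / (subtreeCount T (Fintype.card W) : ℝ)

/-- `max { d(S,T) : T an n-vertex tree }`. -/
noncomputable def maxDensity {W : Type*} [Fintype W] (S : SimpleGraph W) (n : ℕ) : ℝ :=
  sSup {x : ℝ | ∃ T : SimpleGraph (Fin n), T.IsTree ∧ x = density S T}

/-- The inducibility of `S`: `limsup_{n → ∞} max { d(S,T) : T an n-vertex tree }`. -/
noncomputable def inducibility {W : Type*} [Fintype W] (S : SimpleGraph W) : ℝ :=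
  Filter.limsup (maxDensity S) Filter.atTop

/-- A graph is starlike if it has at most one non-leaf vertex. -/
def IsStarlike {V : Type*} (G : SimpleGraph V) : Prop :=
  {v | ndeg G v ≠ 1}.Subsingleton

/-- A graph is pathlike if its maximum degree is at most 2. -/
def IsPathlike {V : Type*} (G : SimpleGraph V) : Prop :=
  ∀ v, ndeg G v ≤ 2

/-- The vertex set of the component of `u` in `G - v`; together with the edge `uv`, this is
the branch of `G` rooted at `v` through its neighbour `u`. -/
def branchSet {V : Type*} (G : SimpleGraph V) (v u : V) : Set V :=
  {w | ∃ p : G.Walk u w, v ∉ p.support}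

/-- The branch of `G` rooted at `v` through `u` is non-trivial if it is not a single edge. -/
def NontrivialBranch {V : Type*} (G : SimpleGraph V) (v u : V) : Prop :=
  G.Adj v u ∧ branchSet G v u ≠ {u}

/-- The branch rooted at `v` through `u` is a fork: non-trivial and isomorphic to a star in
which `v` is a leaf (all vertices of the branch other than `u` and `v` are leaves of `G`). -/
def IsFork {V : Type*} (G : SimpleGraph V) (v u : V) : Prop :=
  NontrivialBranch G v u ∧ ∀ w ∈ branchSet G v u, w ≠ u → ndeg G w = 1

/-- The order of a fork: its number of leaves other than the root. -/
noncomputable def forkOrder {V : Type*} (G : SimpleGraph V) (v u : V) : ℕ :=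
  (branchSet G v u).ncard - 1

/-- A branch is major if it is non-trivial and not a fork. -/
def IsMajor {V : Type*} (G : SimpleGraph V) (v u : V) : Prop :=
  NontrivialBranch G v u ∧ ¬ IsFork G v u

/-- A caterpillar is a tree in which every vertex is the root of at most two
non-trivial branches. -/
def IsCaterpillar {V : Type*} (G : SimpleGraph V) : Prop :=
  G.IsTree ∧ ∀ v, {u | NontrivialBranch G v u}.ncard ≤ 2

/-- A center of `G`: each branch rooted at `v` has at most `|G|/2` edges (the branch through
a neighbour `u` has `(branchSet G v u).ncard` edges). -/
def IsCenter {V : Type*} [Fintype V] (G : SimpleGraph V) (v : V) : Prop :=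
  ∀ u, G.Adj v u → 2 * (branchSet G v u).ncard ≤ Fintype.card V

/-- `v` is the root of at least three non-trivial branches. -/
def RootsThreeNontrivial {V : Type*} (G : SimpleGraph V) (v : V) : Prop :=
  3 ≤ {u | NontrivialBranch G v u}.ncard

/-- A hub of `G`: a vertex `v` that is the only vertex on the path from `v` to the nearest
center of `G` that is the root of at least three non-trivial branches.  (A vertex `w` lies on
the path from `v` to `c` iff `dist v w + dist w c = dist v c`.) -/
def IsHub {V : Type*} [Fintype V] (G : SimpleGraph V) (v : V) : Prop :=
  RootsThreeNontrivial G v ∧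
  ∃ c, IsCenter G c ∧ (∀ c', IsCenter G c' → G.dist v c ≤ G.dist v c') ∧
    ∀ w, G.dist v w + G.dist w c = G.dist v c → w ≠ v → ¬ RootsThreeNontrivial G w

namespace TreeDensity

open scoped Classical Finset

set_option linter.unusedSectionVars false

variable {V : Type*} [Fintype V] {T : SimpleGraph V}

/-- `X` spans a connected subgraph. -/
def Conn (T : SimpleGraph V) (X : Finset V) : Prop := (T.induce (X : Set V)).Connected

/-- The number of neighbours of `v` in `X`. -/
noncomputable def dg (T : SimpleGraph V) (X : Finset V) (v : V) : ℕ := #{w ∈ X | T.Adj v w}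

/-- The number of neighbours of `v` outside `X`. -/
noncomputable def xt (T : SimpleGraph V) (X : Finset V) (v : V) : ℕ :=
  #{b : V | b ∉ X ∧ T.Adj v b}

/-- The leaves of the subgraph spanned by `X`. -/
noncomputable def Lv (T : SimpleGraph V) (X : Finset V) : Finset V := {u ∈ X | dg T X u = 1}

/-- The number of leaf neighbours of `v` in `X`. -/
noncomputable def lf (T : SimpleGraph V) (X : Finset V) (v : V) : ℕ := dg T (Lv T X) v

/-- The number of edges leaving `X`. -/
noncomputable def ex (T : SimpleGraph V) (X : Finset V) : ℕ := ∑ v ∈ X, xt T X v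

/-- Leaves attached to a vertex with at least `j` leaf neighbours. -/
noncomputable def Sj (T : SimpleGraph V) (j : ℕ) (X : Finset V) : Finset V :=
  {u ∈ Lv T X | ∃ v ∈ X, T.Adj v u ∧ j ≤ lf T X v}

/-- Leaves attached to a vertex of degree two. -/
noncomputable def La (T : SimpleGraph V) (X : Finset V) : Finset V :=
  {u ∈ Lv T X | ∃ v ∈ X, T.Adj v u ∧ dg T X v = 2}

/-- The sum of all distances between vertices of `X`. -/
noncomputable def wiener (T : SimpleGraph V) (X : Finset V) : ℕ :=
  ∑ x ∈ X, ∑ y ∈ X, T.dist x y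

lemma exists_isPath_of_conn {X : Finset V} (hX : Conn T X) {u v : V} (hu : u ∈ X) (hv : v ∈ X) :
    ∃ p : T.Walk u v, p.IsPath ∧ (∀ w ∈ p.support, w ∈ X) ∧
      p.length = (T.induce (X : Set V)).dist ⟨u, hu⟩ ⟨v, hv⟩ := by
  obtain ⟨q, hq, hl⟩ := hX.exists_path_of_dist ⟨u, hu⟩ ⟨v, hv⟩
  let f := (Embedding.induce (G := T) (X : Set V)).toHom
  refine ⟨q.map f, ?_, ?_, ?_⟩
  · exact hq.map (Embedding.induce (G := T) (X : Set V)).injective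
  · intro w hw
    have hw' : w ∈ q.support.map f := Walk.support_map f q ▸ hw
    obtain ⟨x, -, rfl⟩ := List.mem_map.1 hw'
    exact x.2
  · exact (Walk.length_map f q).trans hl

lemma isPath_length_eq_dist (hT : T.IsTree) {u v : V} {p : T.Walk u v} (hp : p.IsPath) :
    p.length = T.dist u v := by
  obtain ⟨q, hq, hl⟩ := hT.connected.exists_path_of_dist u v
  have := (hT.isAcyclic.subsingleton_path u v).elim ⟨p, hp⟩ ⟨q, hq⟩
  have h2 : p = q := congrArg Subtype.val this
  rw [h2, hl]

lemma dist_induce_eq (hT : T.IsTree) {X : Finset V} (hX : Conn T X) {u v : V} (hu : u ∈ X)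
    (hv : v ∈ X) : (T.induce (X : Set V)).dist ⟨u, hu⟩ ⟨v, hv⟩ = T.dist u v := by
  obtain ⟨p, hp, -, hl⟩ := exists_isPath_of_conn hX hu hv
  rw [← hl, isPath_length_eq_dist hT hp]

lemma dist_lt_card (hT : T.IsTree) {X : Finset V} (hX : Conn T X) {u v : V} (hu : u ∈ X)
    (hv : v ∈ X) : T.dist u v < #X := by
  rw [← dist_induce_eq hT hX hu hv]
  obtain ⟨q, hq, hl⟩ := hX.exists_path_of_dist ⟨u, hu⟩ ⟨v, hv⟩
  rw [← hl]
  have := hq.length_lt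
  simpa using this

lemma dist_extension (hT : T.IsTree) {X : Finset V} (hX : Conn T X) {b v y : V} (hb : b ∉ X)
    (hv : v ∈ X) (hvb : T.Adj v b) (hy : y ∈ X) : T.dist b y = T.dist v y + 1 := by
  obtain ⟨p, hp, hs, -⟩ := exists_isPath_of_conn hX hv hy
  have : (Walk.cons hvb.symm p).IsPath := by
    rw [Walk.cons_isPath_iff]
    exact ⟨hp, fun h => hb (hs b h)⟩
  rw [← isPath_length_eq_dist hT this, ← isPath_length_eq_dist hT hp, Walk.length_cons]

/-- A vertex outside a connected set has at most one neighbour in it. -/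
lemma eq_of_adj_of_notMem (hT : T.IsTree) {X : Finset V} (hX : Conn T X) {b v w : V} (hb : b ∉ X)
    (hv : v ∈ X) (hw : w ∈ X) (hvb : T.Adj v b) (hwb : T.Adj w b) : v = w := by
  have h1 := dist_extension hT hX hb hv hvb hw
  have h2 : T.dist b w = 1 := dist_eq_one_iff_adj.2 hwb.symm
  have h3 : T.dist v w = 0 := by omega
  exact (hT.connected.dist_eq_zero_iff).1 h3

lemma conn_insert {X : Finset V} (hX : Conn T X) {b v : V} (hv : v ∈ X) (hvb : T.Adj v b) :
    Conn T (insert b X) := by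
  have h := induce_union_connected (G := T) (s := (X : Set V)) (t := {v, b}) hX.preconnected
    (induce_pair_connected_of_adj hvb).preconnected ⟨v, hv, by simp⟩
  have e : ((insert b X : Finset V) : Set V) = (X : Set V) ∪ {v, b} := by
    ext x
    simp only [Finset.coe_insert, Set.mem_insert_iff, Set.mem_union, Set.mem_singleton_iff]
    constructor
    · rintro (h | h)
      · exact Or.inr (Or.inr h)
      · exact Or.inl h
    · rintro (h | h | h)
      · exact Or.inr h
      · exact Or.inr (h ▸ hv)
      · exact Or.inl h
  unfold Conn
  rw [e]
  exact h

lemma conn_erase {X : Finset V} (hX : Conn T X) {u : V} (hu : dg T X u = 1) (hc : 2 ≤ #X) :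
    Conn T (X.erase u) := by
  have h := Preconnected.induce_of_degree_eq_one hX.preconnected
    (s := {x : (X : Set V) | x.1 ≠ u}) (by
      rintro ⟨v, hvX⟩ hv x hx y hy
      have hv : v = u := by simpa using hv
      subst hv
      obtain ⟨a, ha⟩ := Finset.card_eq_one.1 hu
      have hxa : x.1 ∈ ({a} : Finset V) := by
        rw [← ha]; exact Finset.mem_filter.2 ⟨x.2, hx⟩
      have hya : y.1 ∈ ({a} : Finset V) := by
        rw [← ha]; exact Finset.mem_filter.2 ⟨y.2, hy⟩
      rw [Finset.mem_singleton] at hxa hya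
      exact Subtype.ext (hxa.trans hya.symm))
  let f : ((T.induce (X : Set V)).induce {x : (X : Set V) | x.1 ≠ u}) →g
      T.induce ((X.erase u : Finset V) : Set V) :=
    ⟨fun x => ⟨x.1.1, Finset.mem_coe.2 (Finset.mem_erase.2 ⟨x.2, x.1.2⟩)⟩, fun {a b} hab => hab⟩
  have hf : Function.Surjective f := by
    rintro ⟨x, hx⟩
    have hx' := Finset.mem_erase.1 (Finset.mem_coe.1 hx)
    exact ⟨⟨⟨x, hx'.2⟩, hx'.1⟩, rfl⟩
  have hne : (X.erase u).Nonempty := by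
    rw [← Finset.card_pos]
    have := Finset.pred_card_le_card_erase (s := X) (a := u)
    omega
  have : Nonempty ((X.erase u : Finset V) : Set V) := ⟨⟨hne.choose, hne.choose_spec⟩⟩
  exact Connected.mk (h.map f hf)

lemma degree_induce (X : Finset V) (v : V) (hv : v ∈ X) :
    (T.induce (X : Set V)).degree ⟨v, hv⟩ = dg T X v := by
  rw [← card_neighborFinset_eq_degree, dg]
  refine Finset.card_bij (fun x _ => x.1) ?_ ?_ ?_
  · rintro ⟨x, hx⟩ h
    rw [mem_neighborFinset] at h
    exact Finset.mem_filter.2 ⟨hx, h⟩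
  · intro a _ b _ h
    exact Subtype.ext h
  · intro b hb
    obtain ⟨h1, h2⟩ := Finset.mem_filter.1 hb
    exact ⟨⟨b, h1⟩, by rw [mem_neighborFinset]; exact h2, rfl⟩

lemma sum_dg (hT : T.IsTree) {X : Finset V} (hX : Conn T X) : ∑ v ∈ X, dg T X v + 2 = 2 * #X := by
  have ht : (T.induce (X : Set V)).IsTree := ⟨hX, hT.isAcyclic.induce _⟩
  have h1 := ht.card_edgeFinset
  have h2 := (T.induce (X : Set V)).sum_degrees_eq_twice_card_edges
  have h3 : ∑ v : (X : Set V), (T.induce (X : Set V)).degree v = ∑ v ∈ X, dg T X v := by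
    rw [← Finset.sum_coe_sort X]
    exact Finset.sum_congr rfl fun v _ => degree_induce X v.1 v.2
  rw [← h3, h2]
  have h4 : Fintype.card (X : Set V) = #X := by simp
  omega

lemma dg_pos {X : Finset V} (hX : Conn T X) (hc : 2 ≤ #X) {v : V} (hv : v ∈ X) :
    0 < dg T X v := by
  rw [← degree_induce X v hv]
  have : Nontrivial (X : Set V) := by
    obtain ⟨a, ha, b, hb, hab⟩ := Finset.one_lt_card.1 (show 1 < #X by omega)
    exact ⟨⟨a, ha⟩, ⟨b, hb⟩, fun h => hab (congrArg Subtype.val h)⟩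
  exact hX.preconnected.degree_pos_of_nontrivial _

lemma mem_Lv {X : Finset V} {u : V} : u ∈ Lv T X ↔ u ∈ X ∧ dg T X u = 1 := by simp [Lv]

/-- The unique neighbour of a leaf. -/
lemma exists_parent {X : Finset V} {u : V} (hu : u ∈ Lv T X) :
    ∃ z ∈ X, T.Adj z u ∧ ∀ w ∈ X, T.Adj w u → w = z := by
  obtain ⟨a, ha⟩ := Finset.card_eq_one.1 (mem_Lv.1 hu).2
  have h1 : a ∈ ({w ∈ X | T.Adj u w} : Finset V) := by rw [ha]; simp
  rw [Finset.mem_filter] at h1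
  refine ⟨a, h1.1, h1.2.symm, fun w hw hwu => ?_⟩
  have h2 : w ∈ ({w ∈ X | T.Adj u w} : Finset V) := Finset.mem_filter.2 ⟨hw, hwu.symm⟩
  rw [ha] at h2
  simpa using h2

section Insert

variable {R : Finset V} {b p : V}

lemma dg_insert_self (hT : T.IsTree) (hR : Conn T R) (hb : b ∉ R) (hp : p ∈ R)
    (hpb : T.Adj p b) : dg T (insert b R) b = 1 := by
  rw [dg, Finset.card_eq_one]
  refine ⟨p, ?_⟩
  ext w
  simp only [Finset.mem_filter, Finset.mem_insert, Finset.mem_singleton]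
  constructor
  · rintro ⟨rfl | hw, h⟩
    · exact absurd h (T.loopless.irrefl _)
    · exact eq_of_adj_of_notMem hT hR hb hw hp h.symm hpb
  · rintro rfl
    exact ⟨Or.inr hp, hpb.symm⟩

lemma dg_insert_of_not_adj {v : V} (h : ¬ T.Adj v b) : dg T (insert b R) v = dg T R v := by
  rw [dg, Finset.filter_insert, if_neg h, dg]

lemma dg_insert_of_adj {v : V} (hb : b ∉ R) (h : T.Adj v b) :
    dg T (insert b R) v = dg T R v + 1 := by
  rw [dg, Finset.filter_insert, if_pos h, Finset.card_insert_of_notMem, dg]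
  simp [hb]

lemma dg_erase_of_not_adj {v : V} (h : ¬ T.Adj v b) : dg T (R.erase b) v = dg T R v := by
  rw [dg, dg, Finset.filter_erase, Finset.erase_eq_of_notMem]
  simp [h]

lemma dg_erase_of_adj {v : V} (hb : b ∈ R) (h : T.Adj v b) :
    dg T (R.erase b) v + 1 = dg T R v := by
  rw [dg, dg, Finset.filter_erase, Finset.card_erase_add_one]
  simp [h, hb]

lemma dg_mono {A B : Finset V} (h : A ⊆ B) (v : V) : dg T A v ≤ dg T B v :=
  Finset.card_le_card (Finset.filter_subset_filter _ h)

/-- The leaves after attaching a new vertex. -/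
lemma Lv_insert (hT : T.IsTree) (hR : Conn T R) (hc : 2 ≤ #R) (hb : b ∉ R) (hp : p ∈ R)
    (hpb : T.Adj p b) : Lv T (insert b R) = insert b ((Lv T R).erase p) := by
  ext v
  rw [mem_Lv, Finset.mem_insert, Finset.mem_insert, Finset.mem_erase, mem_Lv]
  by_cases hvb : v = b
  · subst hvb
    simp [dg_insert_self hT hR hb hp hpb]
  by_cases hvp : v = p
  · subst hvp
    have h1 := dg_pos hR hc hp
    simp only [hvb, dg_insert_of_adj hb hpb]
    simp
    omega
  · by_cases hvR : v ∈ R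
    · have : ¬ T.Adj v b := fun h => hvp (eq_of_adj_of_notMem hT hR hb hvR hp h hpb)
      simp [hvb, hvp, dg_insert_of_not_adj this]
    · simp [hvb, hvR]

lemma lf_insert_parent (hT : T.IsTree) (hR : Conn T R) (hc : 2 ≤ #R) (hb : b ∉ R) (hp : p ∈ R)
    (hpb : T.Adj p b) : lf T (insert b R) p = lf T R p + 1 := by
  unfold lf
  rw [Lv_insert hT hR hc hb hp hpb, dg_insert_of_adj _ hpb,
    dg_erase_of_not_adj (T.loopless.irrefl _)]
  intro h
  exact hb (mem_Lv.1 (Finset.mem_of_mem_erase h)).1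

lemma lf_insert_eq (hT : T.IsTree) (hR : Conn T R) (hc : 2 ≤ #R) (hb : b ∉ R) (hp : p ∈ R)
    (hpb : T.Adj p b) {v : V} (hv : v ∈ R) (hvp : v ≠ p) (h : p ∉ Lv T R ∨ ¬ T.Adj v p) :
    lf T (insert b R) v = lf T R v := by
  unfold lf
  have : ¬ T.Adj v b := fun h => hvp (eq_of_adj_of_notMem hT hR hb hv hp h hpb)
  rw [Lv_insert hT hR hc hb hp hpb, dg_insert_of_not_adj this]
  rcases h with h | h
  · rw [Finset.erase_eq_of_notMem h]
  · rw [dg_erase_of_not_adj h]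

lemma lf_insert_le (hT : T.IsTree) (hR : Conn T R) (hc : 2 ≤ #R) (hb : b ∉ R) (hp : p ∈ R)
    (hpb : T.Adj p b) {v : V} (hv : v ∈ R) (hvp : v ≠ p) :
    lf T (insert b R) v ≤ lf T R v := by
  unfold lf
  have : ¬ T.Adj v b := fun h => hvp (eq_of_adj_of_notMem hT hR hb hv hp h hpb)
  rw [Lv_insert hT hR hc hb hp hpb, dg_insert_of_not_adj this]
  exact dg_mono (Finset.erase_subset _ _) v

lemma lf_le_insert_add_one (hT : T.IsTree) (hR : Conn T R) (hc : 2 ≤ #R) (hb : b ∉ R)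
    (hp : p ∈ R) (hpb : T.Adj p b) {v : V} : lf T R v ≤ lf T (insert b R) v + 1 := by
  unfold lf
  rw [Lv_insert hT hR hc hb hp hpb]
  have h1 : dg T ((Lv T R).erase p) v ≤ dg T (insert b ((Lv T R).erase p)) v :=
    dg_mono (Finset.subset_insert _ _) v
  by_cases h : p ∈ Lv T R ∧ T.Adj v p
  · have := dg_erase_of_adj h.1 h.2
    omega
  · rw [not_and_or] at h
    rcases h with h | h
    · rw [Finset.erase_eq_of_notMem h] at h1 ⊢
      omega
    · rw [dg_erase_of_not_adj h] at h1
      omega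

lemma xt_insert_add (hb : b ∉ R) {v : V} :
    xt T R v = xt T (insert b R) v + if T.Adj v b then 1 else 0 := by
  unfold xt
  split_ifs with h
  · have : ({x : V | x ∉ R ∧ T.Adj v x} : Finset V) =
        insert b ({x : V | x ∉ insert b R ∧ T.Adj v x} : Finset V) := by
      ext x
      simp only [Finset.mem_filter, Finset.mem_univ, true_and, Finset.mem_insert]
      by_cases hx : x = b
      · subst hx; simp [hb, h]
      · simp [hx]
    rw [this, Finset.card_insert_of_notMem]
    simp
  · congr 1
    ext x
    simp only [Finset.mem_filter, Finset.mem_univ, true_and, Finset.mem_insert]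
    by_cases hx : x = b
    · subst hx; simp [h]
    · simp [hx]

lemma sum_xt_eq (hT : T.IsTree) (hR : Conn T R) (hb : b ∉ R) (hp : p ∈ R) (hpb : T.Adj p b)
    {A : Finset V} (hA : A ⊆ R) :
    ∑ v ∈ A, xt T R v = ∑ v ∈ A, xt T (insert b R) v + if p ∈ A then 1 else 0 := by
  rw [Finset.sum_congr rfl fun v _ => xt_insert_add (v := v) hb, Finset.sum_add_distrib]
  congr 1
  have : ∀ v ∈ A, (if T.Adj v b then 1 else 0) = if p = v then 1 else 0 := by
    intro v hv
    by_cases h : p = v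
    · subst h; simp [hpb]
    · rw [if_neg h, if_neg]
      exact fun h' => h (eq_of_adj_of_notMem hT hR hb (hA hv) hp h' hpb).symm
  rw [Finset.sum_congr rfl this, Finset.sum_ite_eq]

lemma ex_le_insert_add_one (hT : T.IsTree) (hR : Conn T R) (hb : b ∉ R) (hp : p ∈ R)
    (hpb : T.Adj p b) : ex T R ≤ ex T (insert b R) + 1 := by
  unfold ex
  rw [sum_xt_eq hT hR hb hp hpb (Finset.Subset.refl R), if_pos hp, Finset.sum_insert hb]
  omega

end Insert

/-- `R` spans a subtree with at least two vertices and `b` is a new vertex attached to `p`. -/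
structure Att (T : SimpleGraph V) (R : Finset V) (b p : V) : Prop where
  tree : T.IsTree
  conn : Conn T R
  two_le : 2 ≤ #R
  notMem : b ∉ R
  mem : p ∈ R
  adj : T.Adj p b

lemma exists_att (hT : T.IsTree) {X : Finset V} (hX : Conn T X) (hc : 3 ≤ #X) {u : V}
    (hu : u ∈ Lv T X) : ∃ z, Att T (X.erase u) u z := by
  obtain ⟨z, hz, hzu, -⟩ := exists_parent hu
  have hu' := mem_Lv.1 hu
  refine ⟨z, hT, conn_erase hX hu'.2 (by omega), ?_, Finset.notMem_erase _ _,
    Finset.mem_erase.2 ⟨hzu.ne, hz⟩, hzu⟩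
  rw [Finset.card_erase_of_mem hu'.1]
  omega

namespace Att

variable {R : Finset V} {b p : V}

lemma conn_insert (h : Att T R b p)
    : Conn T (insert b R) := TreeDensity.conn_insert h.conn h.mem h.adj

lemma card_insert (h : Att T R b p)
    : #(insert b R) = #R + 1 := Finset.card_insert_of_notMem h.notMem

lemma parent_unique (h : Att T R b p) {v : V} (hv : v ∈ R) (hvb : T.Adj v b) : v = p :=
  eq_of_adj_of_notMem h.tree h.conn h.notMem hv h.mem hvb h.adj

lemma Lv_eq (h : Att T R b p) : Lv T (insert b R) = insert b ((Lv T R).erase p) :=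
  Lv_insert h.tree h.conn h.two_le h.notMem h.mem h.adj

lemma lf_parent (h : Att T R b p) : lf T (insert b R) p = lf T R p + 1 :=
  lf_insert_parent h.tree h.conn h.two_le h.notMem h.mem h.adj

lemma lf_eq (h : Att T R b p) {v : V} (hv : v ∈ R) (hvp : v ≠ p) (h' : p ∉ Lv T R ∨ ¬ T.Adj v p) :
    lf T (insert b R) v = lf T R v :=
  lf_insert_eq h.tree h.conn h.two_le h.notMem h.mem h.adj hv hvp h'

lemma lf_le (h : Att T R b p) {v : V} (hv : v ∈ R) (hvp : v ≠ p) : lf T (insert b R) v ≤ lf T R v :=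
  lf_insert_le h.tree h.conn h.two_le h.notMem h.mem h.adj hv hvp

lemma lf_le_add_one (h : Att T R b p) (v : V) : lf T R v ≤ lf T (insert b R) v + 1 :=
  lf_le_insert_add_one h.tree h.conn h.two_le h.notMem h.mem h.adj

lemma ne (h : Att T R b p) : b ≠ p := h.adj.ne'

lemma new_mem_Lv (h : Att T R b p)
    : b ∈ Lv T (insert b R) := by rw [h.Lv_eq]; exact Finset.mem_insert_self _ _

lemma parent_notMem_Lv (h : Att T R b p) : p ∉ Lv T (insert b R) := by
  rw [h.Lv_eq]; simp [h.ne.symm]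

lemma new_notMem_Lv (h : Att T R b p) : b ∉ Lv T R := fun hb => h.notMem (mem_Lv.1 hb).1

lemma lf_new (h : Att T R b p) : lf T (insert b R) b = 0 := by
  unfold lf dg
  rw [Finset.card_eq_zero, Finset.filter_eq_empty_iff]
  intro x hx hbx
  have hxR : x ∈ R := by
    rcases Finset.mem_insert.1 (mem_Lv.1 hx).1 with rfl | h'
    · exact absurd hbx (T.loopless.irrefl _)
    · exact h'
  have := h.parent_unique hxR hbx.symm
  subst this
  exact h.parent_notMem_Lv hx

lemma card_Lv_of_mem (h : Att T R b p) (hp : p ∈ Lv T R) : #(Lv T (insert b R)) = #(Lv T R) := by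
  rw [h.Lv_eq,
    Finset.card_insert_of_notMem (fun hb => h.new_notMem_Lv (Finset.mem_of_mem_erase hb)),
    Finset.card_erase_add_one hp]

lemma card_Lv_of_notMem (h : Att T R b p)
    (hp : p ∉ Lv T R) : #(Lv T (insert b R)) = #(Lv T R) + 1 := by
  rw [h.Lv_eq, Finset.erase_eq_of_notMem hp, Finset.card_insert_of_notMem h.new_notMem_Lv]

lemma card_Lv_le (h : Att T R b p) : #(Lv T (insert b R)) ≤ #(Lv T R) + 1 := by
  by_cases hp : p ∈ Lv T R
  · rw [h.card_Lv_of_mem hp]; omega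
  · rw [h.card_Lv_of_notMem hp]

lemma card_Lv_ge (h : Att T R b p) : #(Lv T R) ≤ #(Lv T (insert b R)) := by
  by_cases hp : p ∈ Lv T R
  · rw [h.card_Lv_of_mem hp]
  · rw [h.card_Lv_of_notMem hp]; omega

lemma ex_le (h : Att T R b p) : ex T R ≤ ex T (insert b R) + 1 :=
  ex_le_insert_add_one h.tree h.conn h.notMem h.mem h.adj

lemma sum_xt (h : Att T R b p) {A : Finset V} (hA : A ⊆ R) :
    ∑ v ∈ A, xt T R v = ∑ v ∈ A, xt T (insert b R) v + if p ∈ A then 1 else 0 :=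
  sum_xt_eq h.tree h.conn h.notMem h.mem h.adj hA

lemma mem_Lv_of_mem (h : Att T R b p)
    {u : V} (hu : u ∈ Lv T R) (hup : u ≠ p) : u ∈ Lv T (insert b R) := by
  rw [h.Lv_eq]
  exact Finset.mem_insert_of_mem (Finset.mem_erase.2 ⟨hup, hu⟩)

lemma mem_Lv_of_mem_insert (h : Att T R b p)
    {u : V} (hu : u ∈ Lv T (insert b R)) (hub : u ≠ b) : u ∈ Lv T R := by
  rw [h.Lv_eq] at hu
  exact Finset.mem_of_mem_erase ((Finset.mem_insert.1 hu).resolve_left hub)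

lemma new_mem_Sj (h : Att T R b p) {j : ℕ} : b ∈ Sj T j (insert b R) ↔ j ≤ lf T R p + 1 := by
  unfold Sj
  rw [Finset.mem_filter]
  constructor
  · rintro ⟨-, v, hv, hvb, hj⟩
    have hvR : v ∈ R := (Finset.mem_insert.1 hv).resolve_left hvb.ne
    obtain rfl := h.parent_unique hvR hvb
    rwa [h.lf_parent] at hj
  · intro hj
    exact ⟨h.new_mem_Lv, p, Finset.mem_insert_of_mem h.mem, h.adj, by rwa [h.lf_parent]⟩

lemma Sj_subset (h : Att T R b p) {j : ℕ} (hj : 1 ≤ j) :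
    Sj T j (insert b R) ⊆ Sj T j R ∪ {u ∈ Lv T (insert b R) | T.Adj p u ∧ j ≤ lf T R p + 1} := by
  intro u hu
  obtain ⟨hu, w, hw, hwu, hjw⟩ := Finset.mem_filter.1 hu
  rw [Finset.mem_union]
  by_cases hwp : w = p
  · subst hwp
    rw [h.lf_parent] at hjw
    exact Or.inr (Finset.mem_filter.2 ⟨hu, hwu, hjw⟩)
  · left
    rcases Finset.mem_insert.1 hw with rfl | hwR
    · rw [h.lf_new] at hjw; omega
    · have hub : u ≠ b := by
        rintro rfl
        exact hwp (h.parent_unique hwR hwu)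
      exact Finset.mem_filter.2 ⟨h.mem_Lv_of_mem_insert hu hub, w, hwR, hwu,
        hjw.trans (h.lf_le hwR hwp)⟩

lemma Sj_subset_of_lt (h : Att T R b p)
    {j : ℕ} (hj : lf T R p + 1 < j) : Sj T j (insert b R) ⊆ Sj T j R := by
  intro u hu
  rcases Finset.mem_union.1 (h.Sj_subset (by omega) hu) with h1 | h1
  · exact h1
  · have := (Finset.mem_filter.1 h1).2.2
    omega

lemma card_Sj_le (h : Att T R b p)
    {j : ℕ} (hj : 1 ≤ j) : #(Sj T j (insert b R)) ≤ #(Sj T j R) + j := by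
  by_cases h1 : j ≤ lf T R p
  · have : Sj T j (insert b R) ⊆ Sj T j R ∪ {b} := by
      intro u hu
      rcases Finset.mem_union.1 (h.Sj_subset hj hu) with h2 | h2
      · exact Finset.mem_union_left _ h2
      · obtain ⟨h3, h4, -⟩ := Finset.mem_filter.1 h2
        by_cases hub : u = b
        · exact Finset.mem_union_right _ (Finset.mem_singleton.2 hub)
        · exact Finset.mem_union_left _
            (Finset.mem_filter.2 ⟨h.mem_Lv_of_mem_insert h3 hub, p, h.mem, h4, h1⟩)
    have := (Finset.card_le_card this).trans (Finset.card_union_le _ _)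
    rw [Finset.card_singleton] at this
    omega
  · have h2 := (Finset.card_le_card (h.Sj_subset hj)).trans (Finset.card_union_le _ _)
    have h3 : #{u ∈ Lv T (insert b R) | T.Adj p u ∧ j ≤ lf T R p + 1} ≤ lf T (insert b R) p := by
      refine Finset.card_le_card fun x => ?_
      simp only [Finset.mem_filter]
      tauto
    rw [h.lf_parent] at h3
    omega

lemma card_Sj_remove_le (h : Att T R b p)
    {j : ℕ} (hj : 1 ≤ j) : #(Sj T j R) ≤ #(Sj T j (insert b R)) + j := by
  by_cases hp : p ∈ Lv T R
  · obtain ⟨w, hw, hwp, huniq⟩ := exists_parent hp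
    have key : ∀ u ∈ Sj T j R, u ∈ Sj T j (insert b R) ∨ (T.Adj w u ∧ j ≤ lf T R w) := by
      intro u hu
      obtain ⟨hu, v, hv, hvu, hjv⟩ := Finset.mem_filter.1 hu
      by_cases hvw : v = w
      · subst hvw; exact Or.inr ⟨hvu, hjv⟩
      · left
        have hup : u ≠ p := by
          rintro rfl
          exact hvw (huniq v hv hvu)
        refine Finset.mem_filter.2 ⟨h.mem_Lv_of_mem hu hup, v, Finset.mem_insert_of_mem hv, hvu, ?_⟩
        by_cases hvp : v = p
        · subst hvp; rw [h.lf_parent]; omega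
        · rwa [h.lf_eq hv hvp (Or.inr fun h' => hvw (huniq v hv h'))]
    by_cases h1 : j ≤ lf T (insert b R) w
    · have : Sj T j R ⊆ Sj T j (insert b R) ∪ {p} := by
        intro u hu
        rcases key u hu with h2 | h2
        · exact Finset.mem_union_left _ h2
        · by_cases hup : u = p
          · exact Finset.mem_union_right _ (Finset.mem_singleton.2 hup)
          · exact Finset.mem_union_left _ (Finset.mem_filter.2
              ⟨h.mem_Lv_of_mem (Finset.mem_filter.1 hu).1 hup, w, Finset.mem_insert_of_mem hw,
                h2.1, h1⟩)
      have := (Finset.card_le_card this).trans (Finset.card_union_le _ _)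
      rw [Finset.card_singleton] at this
      omega
    · have : Sj T j R ⊆ Sj T j (insert b R) ∪ {u ∈ Lv T R | T.Adj w u} := by
        intro u hu
        rcases key u hu with h2 | h2
        · exact Finset.mem_union_left _ h2
        · exact Finset.mem_union_right _
            (Finset.mem_filter.2 ⟨(Finset.mem_filter.1 hu).1, h2.1⟩)
      have h2 := (Finset.card_le_card this).trans (Finset.card_union_le _ _)
      have h3 := h.lf_le_add_one w
      have h4 : #{u ∈ Lv T R | T.Adj w u} = lf T R w := rfl
      omega
  · have : Sj T j R ⊆ Sj T j (insert b R) := by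
      intro u hu
      obtain ⟨hu, v, hv, hvu, hjv⟩ := Finset.mem_filter.1 hu
      refine Finset.mem_filter.2 ⟨h.mem_Lv_of_mem hu (fun e => hp (e ▸ hu)), v,
        Finset.mem_insert_of_mem hv, hvu, ?_⟩
      by_cases hvp : v = p
      · subst hvp; rw [h.lf_parent]; omega
      · rwa [h.lf_eq hv hvp (Or.inl hp)]
    have := Finset.card_le_card this
    omega

lemma dg_parent (h : Att T R b p)
    : dg T (insert b R) p = dg T R p + 1 := dg_insert_of_adj h.notMem h.adj

lemma dg_eq (h : Att T R b p) {v : V} (hv : v ∈ R) (hvp : v ≠ p) : dg T (insert b R) v = dg T R v :=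
  dg_insert_of_not_adj fun h' => hvp (h.parent_unique hv h')

lemma dg_new (h : Att T R b p) : dg T (insert b R) b = 1 := (mem_Lv.1 h.new_mem_Lv).2

lemma parent_mem_Lv_iff (h : Att T R b p) : p ∈ Lv T R ↔ dg T (insert b R) p = 2 := by
  rw [mem_Lv, h.dg_parent]
  have := h.mem
  constructor
  · rintro ⟨-, h'⟩; omega
  · intro h'; exact ⟨h.mem, by omega⟩

lemma new_mem_La (h : Att T R b p) (hp : p ∈ Lv T R) : b ∈ La T (insert b R) :=
  Finset.mem_filter.2 ⟨h.new_mem_Lv, p, Finset.mem_insert_of_mem h.mem, h.adj,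
    h.parent_mem_Lv_iff.1 hp⟩

lemma card_La_remove_le (h : Att T R b p)
    (hp : p ∉ Lv T R) : #(La T R) ≤ #(La T (insert b R)) + 2 := by
  have : La T R ⊆ La T (insert b R) ∪ {u ∈ R | T.Adj p u ∧ dg T R p = 2} := by
    intro u hu
    obtain ⟨hu, w, hw, hwu, hd⟩ := Finset.mem_filter.1 hu
    by_cases hwp : w = p
    · subst hwp
      exact Finset.mem_union_right _ (Finset.mem_filter.2 ⟨(mem_Lv.1 hu).1, hwu, hd⟩)
    · exact Finset.mem_union_left _ (Finset.mem_filter.2 ⟨h.mem_Lv_of_mem hu fun e => hp (e ▸ hu),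
        w, Finset.mem_insert_of_mem hw, hwu, by rwa [h.dg_eq hw hwp]⟩)
  have h2 := (Finset.card_le_card this).trans (Finset.card_union_le _ _)
  have h3 : #{u ∈ R | T.Adj p u ∧ dg T R p = 2} ≤ 2 := by
    by_cases h4 : dg T R p = 2
    · simp only [h4, and_true]
      exact h4.le
    · simp [h4]
  omega

lemma card_La_le (h : Att T R b p) (hp : p ∈ Lv T R) : #(La T (insert b R)) ≤ #(La T R) + 2 := by
  have : La T (insert b R) ⊆ La T R ∪ {u ∈ insert b R | T.Adj p u} := by
    intro u hu
    obtain ⟨hu, w, hw, hwu, hd⟩ := Finset.mem_filter.1 hu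
    by_cases hwp : w = p
    · subst hwp
      exact Finset.mem_union_right _ (Finset.mem_filter.2 ⟨(mem_Lv.1 hu).1, hwu⟩)
    · rcases Finset.mem_insert.1 hw with rfl | hwR
      · rw [h.dg_new] at hd; omega
      · have hub : u ≠ b := by
          rintro rfl
          exact hwp (h.parent_unique hwR hwu)
        exact Finset.mem_union_left _ (Finset.mem_filter.2 ⟨h.mem_Lv_of_mem_insert hu hub,
          w, hwR, hwu, by rwa [← h.dg_eq hwR hwp]⟩)
  have h2 := (Finset.card_le_card this).trans (Finset.card_union_le _ _)
  have h3 : #{u ∈ insert b R | T.Adj p u} = 2 := h.parent_mem_Lv_iff.1 hp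
  omega

end Att

/-- There is a nonnegative charge of total mass at most `N` such that each member `X` of `𝒮`
satisfies `Q X t`, where `t` is the charge of `X`. -/
def Charged {ι : Type*} (𝒮 : Finset ι) (N : ℝ) (Q : ι → ℝ → Prop) : Prop :=
  ∃ Φ : ι → ℝ, (∀ X, 0 ≤ Φ X) ∧ ∑ X ∈ 𝒮, Φ X ≤ N ∧ ∀ X ∈ 𝒮, Q X (Φ X)

lemma Charged.mono {ι : Type*} {𝒮 : Finset ι} {N : ℝ} {Q Q' : ι → ℝ → Prop}
    (h : Charged 𝒮 N Q) (h' : ∀ X ∈ 𝒮, ∀ t, 0 ≤ t → Q X t → Q' X t) : Charged 𝒮 N Q' := by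
  obtain ⟨Φ, h0, h1, h2⟩ := h
  exact ⟨Φ, h0, h1, fun X hX => h' X hX _ (h0 X) (h2 X hX)⟩

lemma charged_of_fibers {ι β γ : Type*} [DecidableEq γ] (𝒮 ℬ : Finset ι) (U U' : ι → Finset β)
    (π : ι → β → γ)
    (r : ℕ) (hr0 : 0 < r) (hr : ∀ X ∈ ℬ, #(U' X) ≤ r) (a : ι → β → ℝ) (φ : ι → ℝ)
    (hf : ∀ X ∈ 𝒮, ∀ u ∈ U X,
      (#{c ∈ 𝒮.sigma fun Y => U Y | π c.1 c.2 = π X u} : ℝ) ≤ φ X)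
    (hh : ∀ X ∈ 𝒮, ∀ u ∈ U X,
      a X u ≤ (#{c ∈ ℬ.sigma fun Y => U' Y | π c.1 c.2 = π X u} : ℝ)) :
    Charged 𝒮 #ℬ fun X t => ∑ u ∈ U X, a X u ≤ r * t * φ X := by
  set C := 𝒮.sigma fun Y => U Y with hC
  set C' := ℬ.sigma fun Y => U' Y with hC'
  set f : γ → ℝ := fun P => (#{c ∈ C | π c.1 c.2 = P} : ℝ) with hfdef
  set g : γ → ℝ := fun P => (#{c ∈ C' | π c.1 c.2 = P} : ℝ) with hgdef
  have hr' : (0 : ℝ) < r := by exact_mod_cast hr0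
  have hρ : ∀ P, 0 ≤ g P / f P := fun P => div_nonneg (Nat.cast_nonneg _) (Nat.cast_nonneg _)
  refine ⟨fun X => (∑ u ∈ U X, g (π X u) / f (π X u)) / r, fun X =>
    div_nonneg (Finset.sum_nonneg fun u _ => hρ _) hr'.le, ?_, ?_⟩
  · rw [← Finset.sum_div, div_le_iff₀ hr']
    have e1 : ∑ X ∈ 𝒮, ∑ u ∈ U X, g (π X u) / f (π X u)
        = ∑ c ∈ C, (fun P => g P / f P) (π c.1 c.2) := by
      rw [hC, Finset.sum_sigma]
    rw [e1, Finset.sum_comp (fun P => g P / f P) (fun c : (Σ _ : ι, β) => π c.1 c.2)]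
    have e2 : ∀ P ∈ C.image fun c => π c.1 c.2,
        #{c ∈ C | π c.1 c.2 = P} • (g P / f P) = g P := by
      intro P hP
      obtain ⟨c, hc, rfl⟩ := Finset.mem_image.1 hP
      have : (#{d ∈ C | π d.1 d.2 = π c.1 c.2} : ℝ) ≠ 0 := by
        rw [Nat.cast_ne_zero, ← Nat.pos_iff_ne_zero, Finset.card_pos]
        exact ⟨c, Finset.mem_filter.2 ⟨hc, rfl⟩⟩
      rw [nsmul_eq_mul]
      exact mul_div_cancel₀ _ this
    rw [Finset.sum_congr rfl e2]
    have e3 : ∑ P ∈ C.image fun c => π c.1 c.2, g P ≤ (#C' : ℝ) := by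
      have h1 := Finset.sum_card_fiberwise_eq_card_filter C' (C.image fun c => π c.1 c.2)
        (fun c => π c.1 c.2)
      have h2 := Finset.card_filter_le C' fun c => π c.1 c.2 ∈ C.image fun c => π c.1 c.2
      rw [← h1] at h2
      simp only [hgdef]
      exact_mod_cast h2
    have e4 : #C' ≤ r * #ℬ := by
      rw [hC', Finset.card_sigma, mul_comm]
      simpa using Finset.sum_le_card_nsmul ℬ _ r hr
    have e5 : (#C' : ℝ) ≤ r * #ℬ := by exact_mod_cast e4
    linarith
  · intro X hX
    have e1 : (r : ℝ) * ((∑ u ∈ U X, g (π X u) / f (π X u)) / r) * φ X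
        = ∑ u ∈ U X, g (π X u) / f (π X u) * φ X := by
      rw [mul_div_cancel₀ _ hr'.ne', Finset.sum_mul]
    simp only
    rw [e1]
    refine Finset.sum_le_sum fun u hu => (hh X hX u hu).trans ?_
    have hpos : 0 < f (π X u) := by
      simp only [hfdef]
      rw [Nat.cast_pos, Finset.card_pos]
      exact ⟨⟨X, u⟩, Finset.mem_filter.2 ⟨Finset.mem_sigma.2 ⟨hX, hu⟩, rfl⟩⟩
    calc g (π X u) = g (π X u) / f (π X u) * f (π X u) := by field_simp
      _ ≤ _ := mul_le_mul_of_nonneg_left (hf X hX u hu) (hρ _)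

/-- The vertices outside `R` attached to a member of `A`. -/
noncomputable def outer (T : SimpleGraph V) (R A : Finset V) : Finset V :=
  A.biUnion fun v => {b : V | b ∉ R ∧ T.Adj v b}

lemma mem_outer {R A : Finset V} {b : V} : b ∈ outer T R A ↔ b ∉ R ∧ ∃ v ∈ A, T.Adj v b := by
  simp only [outer, Finset.mem_biUnion, Finset.mem_filter, Finset.mem_univ, true_and]
  tauto

lemma card_outer_le (R A : Finset V) : #(outer T R A) ≤ ∑ v ∈ A, xt T R v :=
  Finset.card_biUnion_le

lemma card_outer (hT : T.IsTree) {R A : Finset V} (hR : Conn T R) (hA : A ⊆ R) :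
    #(outer T R A) = ∑ v ∈ A, xt T R v := by
  refine Finset.card_biUnion fun v hv w hw hvw => ?_
  rw [Function.onFun, Finset.disjoint_left]
  intro b hb hb'
  simp only [Finset.mem_filter, Finset.mem_univ, true_and] at hb hb'
  exact hvw (eq_of_adj_of_notMem hT hR hb.1 (hA hv) (hA hw) hb.2 hb'.2)

/-- Charging by deleting a leaf and attaching another vertex. -/
lemma charged_of_moves (hT : T.IsTree) (𝒮 ℬ : Finset (Finset V)) (U U' : Finset V → Finset V)
    (hc : ∀ X ∈ 𝒮, Conn T X ∧ 3 ≤ #X) (hU : ∀ X ∈ 𝒮, U X ⊆ Lv T X)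
    (r : ℕ) (hr0 : 0 < r) (hr : ∀ X ∈ ℬ, #(U' X) ≤ r) (a : Finset V → V → ℕ)
    (φ : Finset V → ℕ)
    (hf : ∀ X ∈ 𝒮, ∀ u ∈ U X, ∀ z, Att T (X.erase u) u z → ∃ A,
      (∀ b p, Att T (X.erase u) b p → insert b (X.erase u) ∈ 𝒮 → b ∈ U (insert b (X.erase u)) →
        p ∈ A) ∧ ∑ v ∈ A, xt T (X.erase u) v ≤ φ X)
    (hh : ∀ X ∈ 𝒮, ∀ u ∈ U X, ∀ z, Att T (X.erase u) u z → ∃ B : Finset V,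
      (∀ b ∈ B, b ∉ X.erase u ∧ insert b (X.erase u) ∈ ℬ ∧ b ∈ U' (insert b (X.erase u))) ∧
        a X u ≤ #B) :
    Charged 𝒮 #ℬ fun X t => ∑ u ∈ U X, (a X u : ℝ) ≤ r * t * φ X := by
  refine charged_of_fibers 𝒮 ℬ U U' (fun X u => X.erase u) r hr0 hr (fun X u => a X u)
    (fun X => φ X) ?_ ?_
  · intro X hX u hu
    obtain ⟨z, hz⟩ := exists_att hT (hc X hX).1 (hc X hX).2 (hU X hX hu)
    obtain ⟨A, hA, hle⟩ := hf X hX u hu z hz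
    refine Nat.cast_le.2 (le_trans ?_ ((card_outer_le (T := T) (X.erase u) A).trans hle))
    refine Finset.card_le_card_of_injOn (fun c => c.2) ?_ ?_
    · rintro ⟨Y, y⟩ hY
      obtain ⟨hY, heq⟩ := Finset.mem_filter.1 (Finset.mem_coe.1 hY)
      obtain ⟨hY, hy⟩ := Finset.mem_sigma.1 hY
      simp only at heq hY hy
      obtain ⟨p, hp⟩ := exists_att hT (hc Y hY).1 (hc Y hY).2 (hU Y hY hy)
      have hins : insert y (X.erase u) = Y := by
        rw [← heq, Finset.insert_erase (mem_Lv.1 (hU Y hY hy)).1]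
      rw [heq] at hp
      have := hA y p hp (hins ▸ hY) (hins ▸ hy)
      exact Finset.mem_coe.2 (mem_outer.2 ⟨hp.notMem, p, this, hp.adj⟩)
    · rintro ⟨Y, y⟩ hY ⟨Y', y'⟩ hY' heq
      obtain ⟨hY, h1⟩ := Finset.mem_filter.1 (Finset.mem_coe.1 hY)
      obtain ⟨hY', h2⟩ := Finset.mem_filter.1 (Finset.mem_coe.1 hY')
      simp only at heq
      subst heq
      obtain ⟨hY, hy⟩ := Finset.mem_sigma.1 hY
      obtain ⟨hY', hy'⟩ := Finset.mem_sigma.1 hY'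
      simp only at h1 h2 hY hy hY' hy'
      have e1 := Finset.insert_erase (mem_Lv.1 (hU Y hY hy)).1
      have e2 := Finset.insert_erase (mem_Lv.1 (hU Y' hY' hy')).1
      rw [h1] at e1
      rw [h2] at e2
      rw [← e1, ← e2]
  · intro X hX u hu
    obtain ⟨z, hz⟩ := exists_att hT (hc X hX).1 (hc X hX).2 (hU X hX hu)
    obtain ⟨B, hB, hle⟩ := hh X hX u hu z hz
    refine Nat.cast_le.2 (hle.trans ?_)
    refine Finset.card_le_card_of_injOn (fun b => ⟨insert b (X.erase u), b⟩) ?_ ?_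
    · intro b hb
      obtain ⟨h1, h2, h3⟩ := hB b hb
      refine Finset.mem_coe.2 (Finset.mem_filter.2 ⟨Finset.mem_sigma.2 ⟨h2, h3⟩, ?_⟩)
      exact Finset.erase_insert h1
    · intro b _ b' _ h
      have := congrArg (fun c : (Σ _ : Finset V, V) => c.2) h
      exact this

lemma exists_of_charged {ι κ : Type*} [Fintype κ] {𝒮 : Finset ι} {N N' : ℝ} {Q : ι → ℝ → Prop}
    {Q' : κ → ι → ℝ → Prop} {K η : ℝ} (hη : 0 < η) (h : Charged 𝒮 N Q)
    (h' : ∀ i, Charged 𝒮 N' (Q' i)) (hlt : N + Fintype.card κ * N' / η < (1 + K) * #𝒮) :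
    ∃ X ∈ 𝒮, (∃ t, 0 ≤ t ∧ t ≤ 1 + K ∧ Q X t) ∧
      ∀ i, ∃ t, 0 ≤ t ∧ t ≤ (1 + K) * η ∧ Q' i X t := by
  obtain ⟨Φ, h0, h1, h2⟩ := h
  choose Ψ k0 k1 k2 using h'
  have hsum : ∑ X ∈ 𝒮, (Φ X + ∑ i, Ψ i X / η) < ∑ X ∈ 𝒮, (1 + K) := by
    rw [Finset.sum_add_distrib, Finset.sum_comm, Finset.sum_const, nsmul_eq_mul]
    have : ∑ i, ∑ X ∈ 𝒮, Ψ i X / η ≤ ∑ i : κ, N' / η := by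
      refine Finset.sum_le_sum fun i _ => ?_
      rw [← Finset.sum_div]
      exact div_le_div_of_nonneg_right (k1 i) hη.le
    rw [Finset.sum_const, nsmul_eq_mul, Finset.card_univ, ← mul_div_assoc] at this
    linarith [mul_comm (1 + K) (#𝒮 : ℝ)]
  obtain ⟨X, hX, hlt⟩ := Finset.exists_lt_of_sum_lt hsum
  have hnn : ∀ i, 0 ≤ Ψ i X / η := fun i => div_nonneg (k0 i X) hη.le
  have hs : 0 ≤ ∑ i, Ψ i X / η := Finset.sum_nonneg fun i _ => hnn i
  refine ⟨X, hX, ⟨Φ X, h0 X, by linarith, h2 X hX⟩, fun i => ⟨Ψ i X, k0 i X, ?_, k2 i X hX⟩⟩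
  have := Finset.single_le_sum (f := fun i => Ψ i X / η) (fun i _ => hnn i) (Finset.mem_univ i)
  have h3 : Ψ i X / η ≤ 1 + K := by linarith [h0 X]
  rwa [div_le_iff₀ hη] at h3

lemma dg_le_card_Lv (hT : T.IsTree) {X : Finset V} (hX : Conn T X) (hc : 2 ≤ #X) {v : V}
    (hv : v ∈ X) : dg T X v ≤ #(Lv T X) := by
  have h1 := sum_dg hT hX
  have h2 : #(Lv T X) = ∑ x ∈ X, if dg T X x = 1 then 1 else 0 := Finset.card_filter _ _
  have h3 : ∑ x ∈ X, dg T X x + #(Lv T X)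
      = ∑ x ∈ X, (dg T X x + if dg T X x = 1 then 1 else 0) := by
    rw [h2, Finset.sum_add_distrib]
  have h4 : #(X.erase v) • 2 ≤ ∑ x ∈ X.erase v, (dg T X x + if dg T X x = 1 then 1 else 0) := by
    refine Finset.card_nsmul_le_sum _ _ _ fun x hx => ?_
    have := dg_pos hX hc (Finset.mem_of_mem_erase hx)
    split_ifs <;> omega
  have h5 := Finset.add_sum_erase X (fun x => dg T X x + if dg T X x = 1 then 1 else 0) hv
  have h6 : 1 ≤ #X := by omega
  rw [Finset.card_erase_of_mem hv, smul_eq_mul] at h4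
  omega

lemma sum_lf (X : Finset V) : ∑ v ∈ X, lf T X v = #(Lv T X) := by
  have h := Finset.sum_card_bipartiteAbove_eq_sum_card_bipartiteBelow (s := X) (t := Lv T X)
    (r := fun v u => T.Adj v u)
  have h1 : ∀ u ∈ Lv T X, #(Finset.bipartiteBelow (fun v u => T.Adj v u) X u) = 1 := by
    intro u hu
    rw [← (mem_Lv.1 hu).2, dg, Finset.bipartiteBelow]
    congr 1
    ext x
    simp only [Finset.mem_filter, T.adj_comm]
  rw [Finset.sum_congr rfl h1, Finset.sum_const, smul_eq_mul, mul_one] at h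
  exact h

/-- The invariants of a fixed isomorphism type of subtrees, abstracted as a predicate `P`. -/
structure Model (T : SimpleGraph V) (k ℓ : ℕ) (s : ℕ → ℕ) (α w : ℕ) (P : Finset V → Prop) :
    Prop where
  tree : T.IsTree
  three_le : 3 ≤ ℓ
  five_le : 5 ≤ k
  card : ∀ {X}, P X → #X = k
  conn : ∀ {X}, P X → Conn T X
  leaves : ∀ {X}, P X → #(Lv T X) = ℓ
  sj : ∀ {X} j, P X → #(Sj T j X) = s j
  la : ∀ {X}, P X → #(La T X) = α
  wien : ∀ {X}, P X → wiener T X = w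
  lf_lt : ∀ {X v}, P X → v ∈ X → lf T X v < dg T X v

section Transport

variable {W : Type*} [Fintype W] {S : SimpleGraph W} {X : Finset V}

lemma card_iso (φ : T.induce (X : Set V) ≃g S) {A : Finset V} {B : Finset W} (hA : A ⊆ X)
    (h : ∀ v (hv : v ∈ X), v ∈ A ↔ φ ⟨v, hv⟩ ∈ B) : #A = #B := by
  refine Finset.card_bij (fun v hv => φ ⟨v, hA hv⟩) ?_ ?_ ?_
  · intro v hv
    exact (h v _).1 hv
  · intro a ha b hb hab
    exact congrArg Subtype.val (φ.injective hab)
  · intro w hw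
    obtain ⟨⟨v, hv⟩, rfl⟩ := φ.surjective w
    exact ⟨v, (h v hv).2 hw, rfl⟩

lemma adj_iso (φ : T.induce (X : Set V) ≃g S) {v u : V} (hv : v ∈ X) (hu : u ∈ X) :
    T.Adj v u ↔ S.Adj (φ ⟨v, hv⟩) (φ ⟨u, hu⟩) :=
  (φ.map_adj_iff (v := ⟨v, hv⟩) (w := ⟨u, hu⟩)).symm

lemma exists_iso (φ : T.induce (X : Set V) ≃g S)
    {p : V → Prop} {q : W → Prop} (h : ∀ v (hv : v ∈ X), p v ↔ q (φ ⟨v, hv⟩)) :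
    (∃ v ∈ X, p v) ↔ ∃ w ∈ (Finset.univ : Finset W), q w := by
  constructor
  · rintro ⟨v, hv, hp⟩
    exact ⟨_, Finset.mem_univ _, (h v hv).1 hp⟩
  · rintro ⟨w, -, hq⟩
    obtain ⟨⟨v, hv⟩, rfl⟩ := φ.surjective w
    exact ⟨v, hv, (h v hv).2 hq⟩

lemma dg_iso (φ : T.induce (X : Set V) ≃g S)
    {v : V} (hv : v ∈ X) : dg T X v = dg S Finset.univ (φ ⟨v, hv⟩) :=
  card_iso φ (Finset.filter_subset _ _) fun u hu => by simp [adj_iso φ hv hu, hu]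

lemma mem_Lv_iso (φ : T.induce (X : Set V) ≃g S)
    {v : V} (hv : v ∈ X) : v ∈ Lv T X ↔ φ ⟨v, hv⟩ ∈ Lv S Finset.univ := by
  simp only [mem_Lv, dg_iso φ hv, hv, Finset.mem_univ]

lemma lf_iso (φ : T.induce (X : Set V) ≃g S)
    {v : V} (hv : v ∈ X) : lf T X v = lf S Finset.univ (φ ⟨v, hv⟩) :=
  card_iso φ (fun _ hu => (mem_Lv.1 (Finset.mem_filter.1 hu).1).1) fun u hu => by
    rw [Finset.mem_filter, Finset.mem_filter, mem_Lv_iso φ hu, adj_iso φ hv hu]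

lemma card_Lv_iso (φ : T.induce (X : Set V) ≃g S) : #(Lv T X) = #(Lv S Finset.univ) :=
  card_iso φ (Finset.filter_subset _ _) fun _ hv => mem_Lv_iso φ hv

lemma card_Sj_iso (φ : T.induce (X : Set V) ≃g S) (j : ℕ) : #(Sj T j X) = #(Sj S j Finset.univ) :=
  card_iso φ (fun _ hu => (mem_Lv.1 (Finset.mem_filter.1 hu).1).1) fun u hu => by
    unfold Sj
    rw [Finset.mem_filter, Finset.mem_filter, mem_Lv_iso φ hu, exists_iso φ (p := fun v => _)
      (q := fun w => S.Adj w (φ ⟨u, hu⟩) ∧ j ≤ lf S Finset.univ w)]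
    exact fun v hv => and_congr (adj_iso φ hv hu) (by rw [lf_iso φ hv])

lemma card_La_iso (φ : T.induce (X : Set V) ≃g S) : #(La T X) = #(La S Finset.univ) :=
  card_iso φ (fun _ hu => (mem_Lv.1 (Finset.mem_filter.1 hu).1).1) fun u hu => by
    unfold La
    rw [Finset.mem_filter, Finset.mem_filter, mem_Lv_iso φ hu, exists_iso φ (p := fun v => _)
      (q := fun w => S.Adj w (φ ⟨u, hu⟩) ∧ dg S Finset.univ w = 2)]
    exact fun v hv => and_congr (adj_iso φ hv hu) (by rw [dg_iso φ hv])

lemma dist_iso (φ : T.induce (X : Set V) ≃g S)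
    (hX : Conn T X) (hS : S.Connected) (a b : (X : Set V)) :
    (T.induce (X : Set V)).dist a b = S.dist (φ a) (φ b) := by
  apply le_antisymm
  · obtain ⟨p, hp⟩ := hS.exists_walk_length_eq_dist (φ a) (φ b)
    have h := dist_le (p.map φ.symm.toHom)
    rw [Walk.length_map, hp] at h
    refine le_trans (le_of_eq ?_) h
    congr 1
    · exact (φ.symm_apply_apply a).symm
    · exact (φ.symm_apply_apply b).symm
  · obtain ⟨p, hp⟩ := hX.exists_walk_length_eq_dist a b
    have h := dist_le (p.map φ.toHom)
    rw [Walk.length_map, hp] at h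
    exact h

lemma wiener_iso (φ : T.induce (X : Set V) ≃g S)
    (hT : T.IsTree) (hX : Conn T X) (hS : S.Connected) :
    wiener T X = ∑ x, ∑ y, S.dist x y := by
  have h1 : wiener T X = ∑ x : (X : Set V), ∑ y : (X : Set V), T.dist x.1 y.1 := by
    unfold wiener
    rw [← Finset.sum_coe_sort X]
    refine Finset.sum_congr rfl fun x _ => ?_
    rw [← Finset.sum_coe_sort X]
    rfl
  rw [h1, ← φ.toEquiv.sum_comp]
  refine Finset.sum_congr rfl fun x _ => ?_
  rw [← φ.toEquiv.sum_comp]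
  refine Finset.sum_congr rfl fun y _ => ?_
  rw [← dist_induce_eq hT hX x.2 y.2]
  exact dist_iso φ hX hS x y

end Transport

section Shape

variable {W : Type*} [Fintype W] {S : SimpleGraph W}

lemma ndeg_eq_dg (v : W) : ndeg S v = dg S (Finset.univ : Finset W) v := by
  unfold ndeg dg
  rw [Set.ncard_eq_toFinset_card']
  congr 1
  ext x
  simp

lemma conn_univ (hS : S.IsTree) : Conn S Finset.univ := by
  unfold Conn
  rw [Finset.coe_univ]
  exact (Iso.connected_iff (induceUnivIso S)).2 hS.connected

lemma lf_lt_dg (hS : S.IsTree) (hstar : ¬ IsStarlike S) (v : W) :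
    lf S Finset.univ v < dg S Finset.univ v := by
  by_contra hcon
  have hsub : ({u ∈ Lv S Finset.univ | S.Adj v u} : Finset W) ⊆
      {u ∈ (Finset.univ : Finset W) | S.Adj v u} :=
    Finset.filter_subset_filter _ (Finset.subset_univ _)
  have heq := Finset.eq_of_subset_of_card_le hsub (not_lt.1 hcon)
  have hleaf : ∀ u, S.Adj v u → u ∈ Lv S Finset.univ := by
    intro u hu
    have : u ∈ ({u ∈ Lv S Finset.univ | S.Adj v u} : Finset W) := by
      rw [heq]; simp [hu]
    exact (Finset.mem_filter.1 this).1
  have hclosed : ∀ {a b : W} (p : S.Walk a b), (a = v ∨ S.Adj v a) → (b = v ∨ S.Adj v b) := by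
    intro a b p
    induction p with
    | nil => exact id
    | cons hac q ih =>
      intro ha
      apply ih
      rcases ha with rfl | ha
      · exact Or.inr hac
      · obtain ⟨z, -, -, hz⟩ := exists_parent (hleaf _ ha)
        left
        rw [hz _ (Finset.mem_univ _) hac.symm, hz v (Finset.mem_univ _) ha]
  apply hstar
  have hall : ∀ x, ndeg S x ≠ 1 → x = v := by
    intro x hx
    obtain ⟨p⟩ := hS.connected.preconnected v x
    rcases hclosed p (Or.inl rfl) with h | h
    · exact h
    · exact absurd (by rw [ndeg_eq_dg]; exact (mem_Lv.1 (hleaf x h)).2) hx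
  intro x hx y hy
  rw [hall x hx, hall y hy]

/-- A tree which is neither a star nor a path yields a model. -/
lemma exists_model (hS : S.IsTree) (hstar : ¬ IsStarlike S) (hpath : ¬ IsPathlike S) :
    ∃ ℓ s α w, ∀ {V : Type} [Fintype V] (T : SimpleGraph V), T.IsTree →
      Model T (Fintype.card W) ℓ s α w
        (fun X => Nonempty (T.induce (X : Set V) ≃g S)) := by
  have hU := conn_univ hS
  obtain ⟨v, hv⟩ := not_forall.1 hpath
  rw [not_le, ndeg_eq_dg] at hv
  have hcard : dg S Finset.univ v + 1 ≤ Fintype.card W := by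
    rw [← Finset.card_univ, ← Finset.card_erase_add_one (Finset.mem_univ v)]
    refine Nat.succ_le_succ (Finset.card_le_card fun x hx => ?_)
    rw [Finset.mem_filter] at hx
    exact Finset.mem_erase.2 ⟨hx.2.ne', hx.1⟩
  have hc2 : 2 ≤ #(Finset.univ : Finset W) := by rw [Finset.card_univ]; omega
  have h3 := dg_le_card_Lv hS hU hc2 (Finset.mem_univ v)
  have h5 : 5 ≤ Fintype.card W := by
    obtain ⟨w, hw, hw'⟩ : ∃ w, S.Adj v w ∧ w ∉ Lv S Finset.univ := by
      by_contra hcon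
      push Not at hcon
      refine (lf_lt_dg hS hstar v).not_ge (Finset.card_le_card fun x hx => ?_)
      have := (Finset.mem_filter.1 hx).2
      exact Finset.mem_filter.2 ⟨hcon x this, this⟩
    have hv' : v ∉ Lv S Finset.univ := fun h => by have := (mem_Lv.1 h).2; omega
    have h6 : Disjoint (Lv S Finset.univ) {v, w} := by
      rw [Finset.disjoint_right]
      intro x hx
      rcases Finset.mem_insert.1 hx with rfl | hx
      · exact hv'
      · rwa [Finset.mem_singleton.1 hx]
    have h7 := Finset.card_le_univ (Lv S Finset.univ ∪ {v, w})
    rw [Finset.card_union_of_disjoint h6, Finset.card_pair hw.ne] at h7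
    omega
  refine ⟨#(Lv S Finset.univ), fun j => #(Sj S j Finset.univ), #(La S Finset.univ),
    ∑ x, ∑ y, S.dist x y, fun {V} _ T hT => ?_⟩
  have hconn : ∀ {X : Finset V}, Nonempty (T.induce (X : Set V) ≃g S) → Conn T X :=
    fun ⟨φ⟩ => (Iso.connected_iff φ).2 hS.connected
  exact
    { tree := hT
      three_le := by omega
      five_le := h5
      card := fun {X} ⟨φ⟩ => by
        rw [← Finset.card_univ]
        exact card_iso φ (Finset.Subset.refl _) fun v hv => by simp [hv]
      conn := hconn
      leaves := fun ⟨φ⟩ => card_Lv_iso φ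
      sj := fun j ⟨φ⟩ => card_Sj_iso φ j
      la := fun ⟨φ⟩ => card_La_iso φ
      wien := fun h => by
        obtain ⟨φ⟩ := h
        exact wiener_iso φ hT (hconn ⟨φ⟩) hS.connected
      lf_lt := fun {X v} ⟨φ⟩ hv => by
        rw [lf_iso φ hv, dg_iso φ hv]
        exact lf_lt_dg hS hstar _ }

end Shape

/-- `A` if it has at most `c` elements, and `∅` otherwise. -/
noncomputable def capped (c : ℕ) (A : Finset V) : Finset V := if #A ≤ c then A else ∅

lemma card_capped_le (c : ℕ) (A : Finset V) : #(capped c A) ≤ c := by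
  unfold capped
  split_ifs with h
  · exact h
  · simp

lemma mem_capped {c : ℕ} {A : Finset V} (h : #A ≤ c) {b : V} (hb : b ∈ A) : b ∈ capped c A := by
  rwa [capped, if_pos h]

/-- The `k`-vertex subtrees violating `P`. -/
noncomputable def bad (T : SimpleGraph V) (k : ℕ) (P : Finset V → Prop) : Finset (Finset V) :=
  {X | #X = k ∧ Conn T X ∧ ¬ P X}

lemma sum_filter_swap {ι κ : Type*} (L : Finset ι) (A : Finset κ) (q : κ → ι → Prop)
    [∀ v u, Decidable (q v u)] (x : κ → ℕ) :
    ∑ u ∈ L, ∑ v ∈ A with q v u, x v = ∑ v ∈ A, x v * #{u ∈ L | q v u} := by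
  simp_rw [Finset.sum_filter]
  rw [Finset.sum_comm]
  refine Finset.sum_congr rfl fun v _ => ?_
  rw [← Finset.sum_filter, Finset.sum_const, smul_eq_mul, mul_comm]

lemma card_filter_not_adj (L : Finset V) (v : V) :
    #{u ∈ L | ¬ T.Adj v u} + dg T L v = #L := by
  rw [dg, add_comm]
  exact Finset.card_filter_add_card_filter_not (s := L) (fun u => T.Adj v u)

lemma Att.of {R : Finset V} {u z b v : V} (h : Att T R u z) (hb : b ∉ R) (hv : v ∈ R)
    (hvb : T.Adj v b) : Att T R b v := ⟨h.tree, h.conn, h.two_le, hb, hv, hvb⟩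

lemma sum_xt_mono {R A : Finset V} {X : Finset V} (h : R ⊆ X) :
    ∑ v ∈ A, xt T X v ≤ ∑ v ∈ A, xt T R v := by
  refine Finset.sum_le_sum fun v _ => Finset.card_le_card fun x => ?_
  simp only [Finset.mem_filter, Finset.mem_univ, true_and]
  exact fun hx => ⟨fun hxR => hx.1 (h hxR), hx.2⟩

lemma Sj_subset_Lv (j : ℕ) (X : Finset V) : Sj T j X ⊆ Lv T X := Finset.filter_subset _ _

lemma La_subset_Lv (X : Finset V) : La T X ⊆ Lv T X := Finset.filter_subset _ _

namespace Model

variable {k ℓ : ℕ} {s : ℕ → ℕ} {α w : ℕ} {P : Finset V → Prop}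

lemma lf_leaf (h : Model T k ℓ s α w P)
    {X : Finset V} (hX : P X) {u : V} (hu : u ∈ Lv T X) : lf T X u = 0 := by
  have := h.lf_lt hX (mem_Lv.1 hu).1
  rw [(mem_Lv.1 hu).2] at this
  omega

lemma not_adj_leaf (h : Model T k ℓ s α w P)
    {X : Finset V} (hX : P X) {u v : V} (hu : u ∈ Lv T X) (hv : v ∈ Lv T X) :
    ¬ T.Adj u v := by
  intro huv
  have h0 := h.lf_leaf hX hu
  unfold lf dg at h0
  rw [Finset.card_eq_zero, Finset.filter_eq_empty_iff] at h0
  exact h0 hv huv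

lemma lf_lt_leaves (h : Model T k ℓ s α w P)
    {X : Finset V} (hX : P X) {v : V} (hv : v ∈ X) : lf T X v < ℓ := by
  have h1 := h.lf_lt hX hv
  have h2 := dg_le_card_Lv h.tree (h.conn hX) (by rw [h.card hX]; linarith [h.five_le]) hv
  rw [h.leaves hX] at h2
  omega

lemma lf_le_of_sj_zero (h : Model T k ℓ s α w P)
    {X : Finset V} (hX : P X) {m : ℕ} (hm : s (m + 1) = 0)
    {v : V} (hv : v ∈ X) : lf T X v ≤ m := by
  by_contra hcon
  have h1 : 0 < lf T X v := by omega
  obtain ⟨u, hu⟩ := Finset.card_pos.1 h1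
  have h2 : u ∈ Sj T (m + 1) X := Finset.mem_filter.2
    ⟨(Finset.mem_filter.1 hu).1, v, hv, (Finset.mem_filter.1 hu).2, by omega⟩
  have h3 := h.sj (m + 1) hX
  rw [hm, Finset.card_eq_zero] at h3
  rw [h3] at h2
  simp at h2

lemma le_sj (h : Model T k ℓ s α w P)
    {X : Finset V} (hX : P X) {m : ℕ} (hm : 0 < s m) : m ≤ s m := by
  rw [← h.sj m hX, Finset.card_pos] at hm
  obtain ⟨u, hu⟩ := hm
  obtain ⟨-, v, hv, -, hm⟩ := Finset.mem_filter.1 hu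
  rw [← h.sj m hX]
  refine hm.trans (Finset.card_le_card fun x hx => ?_)
  exact Finset.mem_filter.2 ⟨(Finset.mem_filter.1 hx).1, v, hv, (Finset.mem_filter.1 hx).2, hm⟩

lemma sj_le (h : Model T k ℓ s α w P) {X : Finset V} (hX : P X) (m : ℕ) : s m ≤ ℓ := by
  rw [← h.sj m hX, ← h.leaves hX]
  exact Finset.card_le_card (Finset.filter_subset _ _)

lemma sj_one (h : Model T k ℓ s α w P) {X : Finset V} (hX : P X) : s 1 = ℓ := by
  rw [← h.sj 1 hX, ← h.leaves hX]
  congr 1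
  refine Finset.filter_true_of_mem fun u hu => ?_
  obtain ⟨z, hz, hzu, -⟩ := exists_parent hu
  exact ⟨z, hz, hzu, Finset.card_pos.2 ⟨u, Finset.mem_filter.2 ⟨hu, hzu⟩⟩⟩

lemma exists_max (h : Model T k ℓ s α w P) {X : Finset V} (hX : P X) :
    ∃ m, 1 ≤ m ∧ 0 < s m ∧ s (m + 1) = 0 ∧ m < ℓ := by
  have h1 := h.sj_one hX
  have h3 := h.three_le
  have hlt : ∀ m, 0 < s m → m < ℓ := by
    intro m hm
    rw [← h.sj m hX, Finset.card_pos] at hm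
    obtain ⟨u, hu⟩ := hm
    obtain ⟨-, v, hv, -, hm⟩ := Finset.mem_filter.1 hu
    exact hm.trans_lt (h.lf_lt_leaves hX hv)
  have hP : 0 < s (Nat.findGreatest (fun j => 0 < s j) ℓ) :=
    Nat.findGreatest_spec (P := fun j => 0 < s j) (m := 1) (by omega) (by omega)
  refine ⟨_, Nat.le_findGreatest (by omega) (by omega), hP, ?_, hlt _ hP⟩
  by_contra hne
  have hpos : 0 < s (Nat.findGreatest (fun j => 0 < s j) ℓ + 1) := Nat.pos_of_ne_zero hne
  have := Nat.le_findGreatest (P := fun j => 0 < s j) (hlt _ hpos).le hpos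
  omega

lemma la_pos (h : Model T k ℓ s α w P) {X : Finset V} (hX : P X) (h2 : s 2 = 0) : 0 < α := by
  by_contra hα
  have hα0 : #(La T X) = 0 := by rw [h.la hX]; omega
  rw [Finset.card_eq_zero] at hα0
  have hc : 2 ≤ #X := by rw [h.card hX]; linarith [h.five_le]
  have hle : ∀ v ∈ X, 2 + lf T X v ≤ dg T X v + if dg T X v = 1 then 1 else 0 := by
    intro v hv
    have h1 := h.lf_le_of_sj_zero hX (m := 1) h2 hv
    have h3 := dg_pos (h.conn hX) hc hv
    have h4 := h.lf_lt hX hv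
    split_ifs with h5
    · omega
    · by_cases h6 : lf T X v = 0
      · omega
      · obtain ⟨u, hu⟩ := Finset.card_pos.1 (Nat.pos_of_ne_zero h6)
        have h7 : dg T X v ≠ 2 := by
          intro h7
          have : u ∈ La T X := Finset.mem_filter.2
            ⟨(Finset.mem_filter.1 hu).1, v, hv, (Finset.mem_filter.1 hu).2, h7⟩
          rw [hα0] at this
          simp at this
        omega
  have h1 := Finset.sum_le_sum hle
  have h2' : #(Lv T X) = ∑ x ∈ X, if dg T X x = 1 then 1 else 0 := Finset.card_filter _ _
  rw [Finset.sum_add_distrib, Finset.sum_add_distrib, sum_lf, ← h2', Finset.sum_const,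
    smul_eq_mul] at h1
  have h3 := sum_dg h.tree (h.conn hX)
  omega

lemma three_le_card (h : Model T k ℓ s α w P) {X : Finset V} (hX : P X) : 3 ≤ #X := by
  rw [h.card hX]; linarith [h.five_le]

lemma move_mem_bad (h : Model T k ℓ s α w P) {X : Finset V} (hX : P X) {u b p : V} (hu : u ∈ X)
    (ha : Att T (X.erase u) b p) (hP : ¬ P (insert b (X.erase u))) :
    insert b (X.erase u) ∈ bad T k P := by
  refine Finset.mem_filter.2 ⟨Finset.mem_univ _, ?_, ha.conn_insert, hP⟩
  rw [ha.card_insert, Finset.card_erase_add_one hu, h.card hX]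

/-- The basic charging scheme, with the set of attachment vertices of all bad moves prescribed. -/
lemma charged_of_attachments (h : Model T k ℓ s α w P) {𝒮 : Finset (Finset V)} (h𝒮 : ∀ X ∈ 𝒮, P X)
    (U U' : Finset V → Finset V) (hU : ∀ X ∈ 𝒮, U X ⊆ Lv T X) (r : ℕ) (hr0 : 0 < r)
    (a φ : Finset V → ℕ) (A B : Finset V → V → Finset V)
    (hf : ∀ X, P X → ∀ u ∈ U X, ∀ z, Att T (X.erase u) u z →
      (∀ b p, Att T (X.erase u) b p → P (insert b (X.erase u)) → b ∈ U (insert b (X.erase u)) →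
        p ∈ A X u) ∧ ∑ v ∈ A X u, xt T (X.erase u) v ≤ φ X)
    (hh : ∀ X, P X → ∀ u ∈ U X, ∀ z, Att T (X.erase u) u z → B X u ⊆ X.erase u ∧
      ∀ b p, Att T (X.erase u) b p → p ∈ B X u → ¬ P (insert b (X.erase u)) ∧
        b ∈ U' (insert b (X.erase u)) ∧ #(U' (insert b (X.erase u))) ≤ r)
    (ha : ∀ X, P X → a X ≤ ∑ u ∈ U X, ∑ v ∈ B X u, xt T X v) :
    Charged 𝒮 #(bad T k P) fun X t => (a X : ℝ) ≤ r * t * φ X := by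
  refine (charged_of_moves h.tree 𝒮 (bad T k P) U (fun X => capped r (U' X))
    (fun X hX => ⟨h.conn (h𝒮 X hX), h.three_le_card (h𝒮 X hX)⟩) hU r hr0
    (fun X _ => card_capped_le _ _) (fun X u => ∑ v ∈ B X u, xt T X v) φ ?_ ?_).mono ?_
  · intro X hX u hu z hz
    obtain ⟨h1, h2⟩ := hf X (h𝒮 X hX) u hu z hz
    exact ⟨A X u, fun b p hb hP hU => h1 b p hb (h𝒮 _ hP) hU, h2⟩
  · intro X hX u hu z hz
    obtain ⟨h1, h2⟩ := hh X (h𝒮 X hX) u hu z hz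
    refine ⟨outer T (X.erase u) (B X u), fun b hb => ?_, ?_⟩
    · obtain ⟨hb, v, hv, hvb⟩ := mem_outer.1 hb
      have hatt := hz.of hb (h1 hv) hvb
      obtain ⟨h3, h4, h5⟩ := h2 b v hatt hv
      exact ⟨hb, h.move_mem_bad (h𝒮 X hX) (mem_Lv.1 (hU X hX hu)).1 hatt h3, mem_capped h5 h4⟩
    · rw [card_outer h.tree hz.conn h1]
      exact sum_xt_mono (Finset.erase_subset _ _)
  · intro X hX t _ hle
    refine le_trans ?_ hle
    have := ha X (h𝒮 X hX)
    calc (a X : ℝ) ≤ ((∑ u ∈ U X, ∑ v ∈ B X u, xt T X v : ℕ) : ℝ) := Nat.cast_le.2 this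
      _ = _ := by push_cast; rfl

end Model

/-- Facts relating `X` to `X.erase u` for a leaf `u` attached to `z`. -/
lemma Att.erase_facts {X : Finset V} {u z : V} (hu : u ∈ X) (hz : Att T (X.erase u) u z) :
    insert u (X.erase u) = X ∧ lf T X z = lf T (X.erase u) z + 1 ∧
    (∀ v ∈ X.erase u, v ≠ z → lf T X v ≤ lf T (X.erase u) v) ∧
    (∀ v ∈ X.erase u, v ≠ z → z ∉ Lv T (X.erase u) → lf T X v = lf T (X.erase u) v) ∧
    ex T (X.erase u) ≤ ex T X + 1 ∧ z ∉ Lv T X := by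
  have hX : insert u (X.erase u) = X := Finset.insert_erase hu
  refine ⟨hX, ?_, fun v hv hvz => ?_, fun v hv hvz hzl => ?_, ?_, ?_⟩
  · have := hz.lf_parent; rwa [hX] at this
  · have := hz.lf_le hv hvz; rwa [hX] at this
  · have := hz.lf_eq hv hvz (Or.inl hzl); rwa [hX] at this
  · have := hz.ex_le; rwa [hX] at this
  · have := hz.parent_notMem_Lv; rwa [hX] at this

lemma Att.sum_xt_le {X A : Finset V} {u z : V} (hu : u ∈ X) (hz : Att T (X.erase u) u z)
    (hA : A ⊆ X.erase u) : ∑ v ∈ A, xt T (X.erase u) v ≤ ∑ v ∈ A, xt T X v + 1 := by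
  rw [hz.sum_xt hA, Finset.insert_erase hu]
  split_ifs <;> omega

lemma Att.le_lf_of_mem_Sj {X : Finset V} {u z : V} {m : ℕ} (hz : Att T (X.erase u) u z)
    (hu : u ∈ Sj T m X) : m ≤ lf T X z := by
  obtain ⟨hu, v, hv, hvu, hm⟩ := Finset.mem_filter.1 hu
  have : v = z := hz.parent_unique (Finset.mem_erase.2 ⟨hvu.ne, hv⟩) hvu
  rwa [← this]

lemma Att.mem_Lv_of_mem_La {X : Finset V} {u z : V} (hz : Att T (X.erase u) u z)
    (hu : u ∈ La T X) : z ∈ Lv T (X.erase u) := by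
  obtain ⟨hu, v, hv, hvu, hm⟩ := Finset.mem_filter.1 hu
  have : v = z := hz.parent_unique (Finset.mem_erase.2 ⟨hvu.ne, hv⟩) hvu
  rw [hz.parent_mem_Lv_iff, Finset.insert_erase (mem_Lv.1 hu).1, ← this]
  exact hm

namespace Model

variable {k ℓ : ℕ} {s : ℕ → ℕ} {α w : ℕ} {P : Finset V → Prop}

lemma facts (h : Model T k ℓ s α w P) {X : Finset V} (hX : P X) {u z : V} (hu : u ∈ Lv T X)
    (hz : Att T (X.erase u) u z) :
    u ∈ X ∧ lf T X u = 0 ∧ lf T X z = lf T (X.erase u) z + 1 ∧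
    (∀ v ∈ X.erase u, v ≠ z → lf T X v ≤ lf T (X.erase u) v) ∧
    (∀ v ∈ X.erase u, v ≠ z → z ∉ Lv T (X.erase u) → lf T X v = lf T (X.erase u) v) ∧
    ex T (X.erase u) ≤ ex T X + 1 ∧ #(Lv T (X.erase u)) ≤ ℓ := by
  have h0 := (mem_Lv.1 hu).1
  obtain ⟨h1, h2, h3, h4, h5, h6⟩ := hz.erase_facts h0
  refine ⟨h0, h.lf_leaf hX hu, h2, h3, h4, h5, ?_⟩
  have := hz.card_Lv_ge
  rwa [h1, h.leaves hX] at this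

lemma notMem_Lv_of_mem_Sj (h : Model T k ℓ s α w P)
    {X : Finset V} (hX : P X) {u z : V} {m : ℕ} (hm : 2 ≤ m)
    (hu : u ∈ Sj T m X) (hz : Att T (X.erase u) u z) : z ∉ Lv T (X.erase u) := by
  have hu' := (mem_Lv.1 (Sj_subset_Lv _ _ hu)).1
  rw [hz.parent_mem_Lv_iff, Finset.insert_erase hu']
  have h1 := hz.le_lf_of_mem_Sj hu
  have h2 := h.lf_lt hX (Finset.mem_of_mem_erase hz.mem)
  omega

lemma charged_top (h : Model T k ℓ s α w P)
    {𝒮 : Finset (Finset V)} (h𝒮 : ∀ X ∈ 𝒮, P X) {m : ℕ} (hm : 1 ≤ m)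
    (hs : s (m + 1) = 0) : Charged 𝒮 #(bad T k P) fun X t =>
      (((ℓ - m) * ∑ v ∈ X with m ≤ lf T X v, xt T X v : ℕ) : ℝ)
        ≤ (2 * (m + 1) : ℕ) * t * (ex T X + 1 : ℕ) := by
  refine h.charged_of_attachments h𝒮 (fun X => Lv T X) (fun X => Sj T (m + 1) X)
    (fun _ _ => subset_rfl) (2 * (m + 1)) (by omega) _ _ (fun X u => X.erase u)
    (fun X u => {v ∈ {v ∈ X | m ≤ lf T X v} | ¬ T.Adj v u}) ?_ ?_ ?_
  · intro X hX u hu z hz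
    exact ⟨fun b p hb _ _ => hb.mem, (h.facts hX hu hz).2.2.2.2.2.1⟩
  · intro X hX u hu z hz
    obtain ⟨h1, h2, h3, h4, -, -, -⟩ := h.facts hX hu hz
    have hsub : {v ∈ {v ∈ X | m ≤ lf T X v} | ¬ T.Adj v u} ⊆ X.erase u := by
      intro v hv
      simp only [Finset.mem_filter] at hv
      refine Finset.mem_erase.2 ⟨?_, hv.1.1⟩
      rintro rfl
      omega
    refine ⟨hsub, fun b p hb hp => ?_⟩
    have hpR := hsub hp
    simp only [Finset.mem_filter] at hp
    have hpz : p ≠ z := by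
      rintro rfl
      exact hp.2 hz.adj
    have h5 := h4 p hpR hpz
    refine ⟨fun hP => ?_, hb.new_mem_Sj.2 (by omega), ?_⟩
    · have := h.lf_le_of_sj_zero hP hs (Finset.mem_insert_of_mem hpR)
      rw [hb.lf_parent] at this
      omega
    · have h6 := hb.card_Sj_le (j := m + 1) (by omega)
      have h7 := hz.card_Sj_remove_le (j := m + 1) (by omega)
      rw [Finset.insert_erase h1, h.sj _ hX, hs] at h7
      omega
  · intro X hX
    rw [sum_filter_swap _ _ fun v u => ¬ T.Adj v u, Finset.mul_sum]
    refine Finset.sum_le_sum fun v hv => ?_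
    rw [mul_comm]
    refine Nat.mul_le_mul_left _ ?_
    have h1 := card_filter_not_adj (T := T) (Lv T X) v
    have h2 := h.lf_le_of_sj_zero hX hs (Finset.mem_filter.1 hv).1
    rw [h.leaves hX] at h1
    unfold lf at h2
    omega

lemma charged_low (h : Model T k ℓ s α w P)
    {𝒮 : Finset (Finset V)} (h𝒮 : ∀ X ∈ 𝒮, P X) {m : ℕ} (hm : 2 ≤ m) :
    Charged 𝒮 #(bad T k P) fun X t =>
      (((s m - 1) * ∑ v ∈ X with lf T X v + 1 < m, xt T X v : ℕ) : ℝ)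
        ≤ (ℓ + 1 : ℕ) * t * (∑ v ∈ X with m ≤ lf T X v + 1, xt T X v + 1 : ℕ) := by
  refine h.charged_of_attachments h𝒮 (fun X => Sj T m X) (fun X => Lv T X)
    (fun _ _ => Sj_subset_Lv _ _) (ℓ + 1) (by omega) _ _
    (fun X u => {v ∈ X.erase u | m ≤ lf T (X.erase u) v + 1})
    (fun X u => {v ∈ X.erase u | lf T X v + 1 < m}) ?_ ?_ ?_
  · intro X hX u hu z hz
    have hzl := h.notMem_Lv_of_mem_Sj hX hm hu hz
    obtain ⟨h1, h2, h3, h4, h5, -, -⟩ := h.facts hX (Sj_subset_Lv _ _ hu) hz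
    refine ⟨fun b p hb _ hbS => Finset.mem_filter.2 ⟨hb.mem, hb.new_mem_Sj.1 hbS⟩, ?_⟩
    refine (hz.sum_xt_le h1 (Finset.filter_subset _ _)).trans (Nat.add_le_add_right ?_ 1)
    refine Finset.sum_le_sum_of_subset fun v hv => ?_
    obtain ⟨hv, hle⟩ := Finset.mem_filter.1 hv
    refine Finset.mem_filter.2 ⟨Finset.mem_of_mem_erase hv, ?_⟩
    by_cases hvz : v = z
    · subst hvz; omega
    · rw [h5 v hv hvz hzl]; exact hle
  · intro X hX u hu z hz
    have hzl := h.notMem_Lv_of_mem_Sj hX hm hu hz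
    obtain ⟨h1, h2, h3, h4, h5, -, h7⟩ := h.facts hX (Sj_subset_Lv _ _ hu) hz
    refine ⟨Finset.filter_subset _ _, fun b p hb hp => ?_⟩
    obtain ⟨hpR, hlt⟩ := Finset.mem_filter.1 hp
    have hpz : p ≠ z := by
      rintro rfl
      have := hz.le_lf_of_mem_Sj hu
      omega
    have h8 := h5 p hpR hpz hzl
    refine ⟨fun hP => ?_, hb.new_mem_Lv, ?_⟩
    · have h9 := hb.Sj_subset_of_lt (j := m) (by omega)
      have h10 : Sj T m (X.erase u) ⊆ (Sj T m X).erase u := by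
        intro y hy
        obtain ⟨hy, v, hv, hvy, hle⟩ := Finset.mem_filter.1 hy
        have hyu : y ≠ u := by
          rintro rfl
          exact Finset.notMem_erase y X (mem_Lv.1 hy).1
        refine Finset.mem_erase.2 ⟨hyu, Finset.mem_filter.2 ⟨?_, v, Finset.mem_of_mem_erase hv,
          hvy, ?_⟩⟩
        · have := hz.mem_Lv_of_mem hy fun e => hzl (e ▸ hy)
          rwa [Finset.insert_erase h1] at this
        · by_cases hvz : v = z
          · subst hvz; omega
          · rw [h5 v hv hvz hzl]; exact hle
      have h11 := Finset.card_le_card (h9.trans h10)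
      rw [h.sj m hP, Finset.card_erase_of_mem hu, h.sj m hX] at h11
      have : 0 < s m := by
        rw [← h.sj m hX]
        exact Finset.card_pos.2 ⟨u, hu⟩
      omega
    · have := hb.card_Lv_le
      omega
  · intro X hX
    have h1 : ∀ u ∈ Sj T m X, ∑ v ∈ X with lf T X v + 1 < m, xt T X v
        = ∑ v ∈ X.erase u with lf T X v + 1 < m, xt T X v + xt T X u := by
      intro u hu
      have hu' := Sj_subset_Lv _ _ hu
      rw [Finset.filter_erase, Finset.sum_erase_add]
      refine Finset.mem_filter.2 ⟨(mem_Lv.1 hu').1, ?_⟩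
      rw [h.lf_leaf hX hu']
      omega
    have h2 := Finset.sum_congr rfl h1
    rw [Finset.sum_add_distrib, Finset.sum_const, h.sj m hX, smul_eq_mul] at h2
    have h3 : ∑ u ∈ Sj T m X, xt T X u ≤ ∑ v ∈ X with lf T X v + 1 < m, xt T X v := by
      refine Finset.sum_le_sum_of_subset fun u hu => ?_
      have hu' := Sj_subset_Lv _ _ hu
      refine Finset.mem_filter.2 ⟨(mem_Lv.1 hu').1, ?_⟩
      rw [h.lf_leaf hX hu']
      omega
    rw [Nat.sub_mul, one_mul]
    omega

lemma charged_low_one (h : Model T k ℓ s α w P) {𝒮 : Finset (Finset V)} (h𝒮 : ∀ X ∈ 𝒮, P X) :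
    Charged 𝒮 #(bad T k P) fun X t =>
      ((α * ∑ v ∈ X with v ∉ Lv T X ∧ lf T X v = 0, xt T X v : ℕ) : ℝ)
        ≤ (ℓ + 1 : ℕ) * t * (∑ v ∈ X with v ∈ Lv T X ∨ 1 ≤ lf T X v, xt T X v + 1 : ℕ) := by
  refine h.charged_of_attachments h𝒮 (fun X => La T X) (fun X => Lv T X)
    (fun _ _ => La_subset_Lv _) (ℓ + 1) (by omega) _ _
    (fun X u => Lv T (X.erase u))
    (fun X u => {v ∈ X | v ∉ Lv T X ∧ lf T X v = 0}) ?_ ?_ ?_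
  · intro X hX u hu z hz
    obtain ⟨h1, h2, h3, h4, h5, -, -⟩ := h.facts hX (La_subset_Lv _ hu) hz
    refine ⟨fun b p hb _ hbS => ?_, ?_⟩
    · have hb' : Att T ((insert b (X.erase u)).erase b) b p := by
        rwa [Finset.erase_insert hb.notMem]
      have := hb'.mem_Lv_of_mem_La hbS
      rwa [Finset.erase_insert hb.notMem] at this
    refine (hz.sum_xt_le h1 (Finset.filter_subset _ _)).trans (Nat.add_le_add_right ?_ 1)
    refine Finset.sum_le_sum_of_subset fun v hv => ?_
    refine Finset.mem_filter.2 ⟨Finset.mem_of_mem_erase (mem_Lv.1 hv).1, ?_⟩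
    by_cases hvz : v = z
    · subst hvz; right; omega
    · left
      have := hz.mem_Lv_of_mem hv hvz
      rwa [Finset.insert_erase h1] at this
  · intro X hX u hu z hz
    have hzl := hz.mem_Lv_of_mem_La hu
    obtain ⟨h1, h2, h3, h4, h5, -, h7⟩ := h.facts hX (La_subset_Lv _ hu) hz
    refine ⟨fun v hv => ?_, fun b p hb hp => ?_⟩
    · obtain ⟨hv, hvl, -⟩ := Finset.mem_filter.1 hv
      refine Finset.mem_erase.2 ⟨?_, hv⟩
      rintro rfl
      exact hvl (La_subset_Lv _ hu)
    · obtain ⟨hpX, hpl, hp0⟩ := Finset.mem_filter.1 hp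
      have hpz : p ≠ z := by
        rintro rfl
        omega
      have hpl' : p ∉ Lv T (X.erase u) := by
        intro hp'
        have := hz.mem_Lv_of_mem hp' hpz
        rw [Finset.insert_erase h1] at this
        exact hpl this
      have h8 := hb.card_Lv_of_notMem hpl'
      have h9 := hz.card_Lv_of_mem hzl
      rw [Finset.insert_erase h1, h.leaves hX] at h9
      refine ⟨fun hP => ?_, hb.new_mem_Lv, by omega⟩
      rw [h.leaves hP] at h8
      omega
  · intro X hX
    rw [Finset.sum_const, h.la hX, smul_eq_mul]

lemma charged_mid (h : Model T k ℓ s α w P)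
    {𝒮 : Finset (Finset V)} (h𝒮 : ∀ X ∈ 𝒮, P X) {m : ℕ} (hm : 2 ≤ m)
    (hs : 0 < s m) : Charged 𝒮 #(bad T k P) fun X t =>
      (((ℓ - s m - (m - 1)) * ∑ v ∈ X with lf T X v + 1 = m, xt T X v : ℕ) : ℝ)
        ≤ (3 * s m : ℕ) * t * (ex T X + 1 : ℕ) := by
  refine h.charged_of_attachments h𝒮 (fun X => Lv T X \ Sj T m X) (fun X => Sj T m X)
    (fun _ _ => Finset.sdiff_subset) (3 * s m) (by omega) _ _ (fun X u => X.erase u)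
    (fun X u => {v ∈ {v ∈ X | lf T X v + 1 = m} | ¬ T.Adj v u}) ?_ ?_ ?_
  · intro X hX u hu z hz
    exact ⟨fun b p hb _ _ => hb.mem, (h.facts hX (Finset.sdiff_subset hu) hz).2.2.2.2.2.1⟩
  · intro X hX u hu z hz
    obtain ⟨hu, huS⟩ := Finset.mem_sdiff.1 hu
    obtain ⟨h1, h2, h3, h4, -, -, -⟩ := h.facts hX hu hz
    have hsub : {v ∈ {v ∈ X | lf T X v + 1 = m} | ¬ T.Adj v u} ⊆ X.erase u := by
      intro v hv
      simp only [Finset.mem_filter] at hv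
      refine Finset.mem_erase.2 ⟨?_, hv.1.1⟩
      rintro rfl
      omega
    refine ⟨hsub, fun b p hb hp => ?_⟩
    have hpR := hsub hp
    simp only [Finset.mem_filter] at hp
    have hpz : p ≠ z := by
      rintro rfl
      exact hp.2 hz.adj
    have h5 := h4 p hpR hpz
    have hpl : p ∉ Lv T (X.erase u) := by
      intro hp'
      have h6 := hz.dg_eq hpR hpz
      rw [Finset.insert_erase h1, (mem_Lv.1 hp').2] at h6
      have := h.lf_lt hX hp.1.1
      omega
    have hbS : b ∈ Sj T m (insert b (X.erase u)) := hb.new_mem_Sj.2 (by omega)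
    refine ⟨fun hP => ?_, hbS, ?_⟩
    · have hss : insert b (Sj T m X) ⊆ Sj T m (insert b (X.erase u)) := by
        refine Finset.insert_subset hbS fun y hy => ?_
        obtain ⟨hyL, v, hv, hvy, hle⟩ := Finset.mem_filter.1 hy
        have hvz : v ≠ z := by
          rintro rfl
          exact huS (Finset.mem_filter.2 ⟨hu, v, hv, hz.adj, hle⟩)
        have hyu : y ≠ u := by rintro rfl; exact huS hy
        have hvu : v ≠ u := by rintro rfl; omega
        have hvR : v ∈ X.erase u := Finset.mem_erase.2 ⟨hvu, hv⟩
        have hyR : y ∈ Lv T (X.erase u) := hz.mem_Lv_of_mem_insert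
          (by rwa [Finset.insert_erase h1]) hyu
        have hvp : v ≠ p := by rintro rfl; omega
        refine Finset.mem_filter.2 ⟨hb.mem_Lv_of_mem hyR fun e => hpl (e ▸ hyR), v,
          Finset.mem_insert_of_mem hvR, hvy, ?_⟩
        rw [hb.lf_eq hvR hvp (Or.inl hpl)]
        exact hle.trans (h4 v hvR hvz)
      have hbX : b ∉ Sj T m X := by
        intro hbX
        have hbX' := (mem_Lv.1 (Sj_subset_Lv _ _ hbX)).1
        have : b ≠ u := by rintro rfl; exact huS hbX
        exact hb.notMem (Finset.mem_erase.2 ⟨this, hbX'⟩)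
      have := Finset.card_le_card hss
      rw [Finset.card_insert_of_notMem hbX, h.sj m hX, h.sj m hP] at this
      omega
    · have h6 := hb.card_Sj_le (j := m) (by omega)
      have h7 := hz.card_Sj_remove_le (j := m) (by omega)
      rw [Finset.insert_erase h1, h.sj _ hX] at h7
      have := h.le_sj hX hs
      omega
  · intro X hX
    rw [sum_filter_swap _ _ fun v u => ¬ T.Adj v u, Finset.mul_sum]
    refine Finset.sum_le_sum fun v hv => ?_
    rw [mul_comm]
    refine Nat.mul_le_mul_left _ ?_
    have h1 := card_filter_not_adj (T := T) (Lv T X \ Sj T m X) v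
    rw [Finset.card_sdiff_of_subset (Sj_subset_Lv _ _), h.leaves hX, h.sj m hX] at h1
    have h2 : dg T (Lv T X \ Sj T m X) v ≤ lf T X v := dg_mono Finset.sdiff_subset v
    have h3 := (Finset.mem_filter.1 hv).2
    omega

lemma charged_mid_one (h : Model T k ℓ s α w P)
    {𝒮 : Finset (Finset V)} (h𝒮 : ∀ X ∈ 𝒮, P X) (hα : 0 < α) :
    Charged 𝒮 #(bad T k P) fun X t =>
      (((ℓ - α - 1) * ∑ v ∈ Lv T X, xt T X v : ℕ) : ℝ)
        ≤ (5 * α : ℕ) * t * (ex T X + 1 : ℕ) := by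
  refine h.charged_of_attachments h𝒮 (fun X => Lv T X \ La T X) (fun X => La T X)
    (fun _ _ => Finset.sdiff_subset) (5 * α) (by omega) _ _ (fun X u => X.erase u)
    (fun X u => {v ∈ Lv T X | v ≠ u}) ?_ ?_ ?_
  · intro X hX u hu z hz
    exact ⟨fun b p hb _ _ => hb.mem, (h.facts hX (Finset.sdiff_subset hu) hz).2.2.2.2.2.1⟩
  · intro X hX u hu z hz
    obtain ⟨hu, huS⟩ := Finset.mem_sdiff.1 hu
    obtain ⟨h1, h2, h3, h4, -, -, -⟩ := h.facts hX hu hz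
    refine ⟨fun v hv => ?_, fun b p hb hp => ?_⟩
    · obtain ⟨hv, hvu⟩ := Finset.mem_filter.1 hv
      exact Finset.mem_erase.2 ⟨hvu, (mem_Lv.1 hv).1⟩
    · obtain ⟨hpL, hpu⟩ := Finset.mem_filter.1 hp
      have hpR : p ∈ Lv T (X.erase u) := hz.mem_Lv_of_mem_insert
        (by rwa [Finset.insert_erase h1]) hpu
      have hzl : z ∉ Lv T (X.erase u) := by
        intro hzl
        have := hz.new_mem_La hzl
        rw [Finset.insert_erase h1] at this
        exact huS this
      have h8 := hb.card_Lv_of_mem hpR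
      have h9 := hz.card_Lv_of_notMem hzl
      have h10 := hb.card_La_le hpR
      have h11 := hz.card_La_remove_le hzl
      rw [Finset.insert_erase h1] at h9 h11
      rw [h.la hX] at h11
      rw [h.leaves hX] at h9
      refine ⟨fun hP => ?_, hb.new_mem_La hpR, by omega⟩
      rw [h.leaves hP] at h8
      omega
  · intro X hX
    rw [sum_filter_swap _ _ fun v u => v ≠ u, Finset.mul_sum]
    refine Finset.sum_le_sum fun v hv => ?_
    rw [mul_comm]
    refine Nat.mul_le_mul_left _ ?_
    have h1 : (Lv T X \ La T X).erase v ⊆ {u ∈ Lv T X \ La T X | v ≠ u} := fun y hy =>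
      Finset.mem_filter.2 ⟨Finset.mem_of_mem_erase hy, (Finset.ne_of_mem_erase hy).symm⟩
    have h2 := Finset.card_le_card h1
    have h3 := Finset.pred_card_le_card_erase (s := Lv T X \ La T X) (a := v)
    rw [Finset.card_sdiff_of_subset (La_subset_Lv _), h.leaves hX, h.la hX] at h3
    omega

end Model

lemma lf_add_lf_le {X : Finset V} {v c : V} (hv : v ∈ X)
    (hc : c ∈ X) (hvc : v ≠ c) : lf T X v + lf T X c ≤ #(Lv T X) := by
  unfold lf dg
  rw [← Finset.card_union_of_disjoint]
  · exact Finset.card_le_card (Finset.union_subset (Finset.filter_subset _ _)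
      (Finset.filter_subset _ _))
  · rw [Finset.disjoint_left]
    intro u hu hu'
    obtain ⟨hu, h1⟩ := Finset.mem_filter.1 hu
    obtain ⟨-, h2⟩ := Finset.mem_filter.1 hu'
    obtain ⟨z, -, -, hz⟩ := exists_parent hu
    exact hvc ((hz v hv h1).trans (hz c hc h2).symm)

/-- The members of `X` closest to `r`, provided there is just one. -/
noncomputable def closest (T : SimpleGraph V) (r : V) (X : Finset V) : Finset V :=
  {x ∈ X | ∀ y ∈ X, y ≠ x → T.dist x r < T.dist y r}

lemma card_closest_le (r : V) (X : Finset V) : #(closest T r X) ≤ 1 := by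
  rw [Finset.card_le_one]
  intro a ha b hb
  obtain ⟨ha, ha'⟩ := Finset.mem_filter.1 ha
  obtain ⟨hb, hb'⟩ := Finset.mem_filter.1 hb
  by_contra hab
  exact lt_asymm (ha' b hb (Ne.symm hab)) (hb' a ha hab)

lemma exists_closer (hT : T.IsTree) {R : Finset V} (hR : R.Nonempty) {r : V} (hr : r ∉ R) :
    ∃ x ∈ R, ∃ w, T.Adj x w ∧ w ∉ R ∧ ∀ y ∈ R, T.dist w r < T.dist y r := by
  obtain ⟨x, hx, hmin⟩ := Finset.exists_min_image R (fun y => T.dist y r) hR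
  have hxr : x ≠ r := fun e => hr (e ▸ hx)
  obtain ⟨w, hw, hd⟩ : ∃ w, T.Adj x w ∧ T.dist w r < T.dist x r := by
    obtain ⟨p, hp⟩ := hT.connected.exists_walk_length_eq_dist x r
    cases p with
    | nil => exact absurd rfl hxr
    | cons hadj q =>
      refine ⟨_, hadj, ?_⟩
      rw [← hp, Walk.length_cons]
      exact Nat.lt_succ_of_le (dist_le q)
  refine ⟨x, hx, w, hw, fun hwR => ?_, fun y hy => hd.trans_le (hmin y hy)⟩
  exact absurd (hmin w hwR) (not_le.2 hd)

/-- The `k`-vertex subtrees. -/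
noncomputable def subtrees (T : SimpleGraph V) (k : ℕ) : Finset (Finset V) :=
  {X | #X = k ∧ Conn T X}

namespace Model

variable {k ℓ : ℕ} {s : ℕ → ℕ} {α w : ℕ} {P : Finset V → Prop}

lemma charged_towards (h : Model T k ℓ s α w P) {𝒮 : Finset (Finset V)} (h𝒮 : ∀ X ∈ 𝒮, P X) (r : V)
    (hr : ∀ X ∈ 𝒮, r ∉ X) :
    Charged 𝒮 #(subtrees T k) fun X t => (ℓ : ℝ) ≤ t * (ex T X + 1 : ℕ) := by
  refine (charged_of_moves h.tree 𝒮 (subtrees T k) (fun X => Lv T X) (closest T r)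
    (fun X hX => ⟨h.conn (h𝒮 X hX), h.three_le_card (h𝒮 X hX)⟩) (fun _ _ => subset_rfl) 1
    one_pos (fun X _ => card_closest_le _ _) (fun _ _ => 1) (fun X => ex T X + 1) ?_ ?_).mono ?_
  · intro X hX u hu z hz
    exact ⟨X.erase u, fun b p hb _ _ => hb.mem, (h.facts (h𝒮 X hX) hu hz).2.2.2.2.2.1⟩
  · intro X hX u hu z hz
    obtain ⟨x, hx, y, hy, hyR, hlt⟩ := exists_closer h.tree ⟨z, hz.mem⟩
      (fun e => hr X hX (Finset.mem_of_mem_erase e))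
    have ha := hz.of hyR hx hy
    refine ⟨{y}, fun b hb => ?_, by simp⟩
    rw [Finset.mem_singleton] at hb
    subst hb
    refine ⟨hyR, Finset.mem_filter.2 ⟨Finset.mem_univ _, ?_, ha.conn_insert⟩,
      Finset.mem_filter.2 ⟨Finset.mem_insert_self _ _, fun c hc hcb => ?_⟩⟩
    · rw [ha.card_insert, Finset.card_erase_add_one (mem_Lv.1 hu).1, h.card (h𝒮 X hX)]
    · exact hlt c ((Finset.mem_insert.1 hc).resolve_left hcb)
  · intro X hX t _ hle
    simpa [h.leaves (h𝒮 X hX)] using hle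

lemma charged_heavy_low (h : Model T k ℓ s α w P)
    {𝒮 : Finset (Finset V)} (h𝒮 : ∀ X ∈ 𝒮, P X) {m : ℕ}
    (hm : 9 * ℓ < 10 * m) (hmℓ : m < ℓ) (hs : s (m + 1) = 0) :
    Charged 𝒮 #(bad T k P) fun X t =>
      (((s m - 1) * ∑ v ∈ X with lf T X v < m, xt T X v : ℕ) : ℝ)
        ≤ (ℓ - m + 3 : ℕ) * t * (∑ v ∈ X with m ≤ lf T X v, xt T X v + 1 : ℕ) := by
  refine h.charged_of_attachments h𝒮 (fun X => Sj T m X)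
    (fun X => Lv T X \ Sj T (m - 2) X)
    (fun _ _ => Sj_subset_Lv _ _) (ℓ - m + 3) (by omega) _ _
    (fun X u => {v ∈ X.erase u | m ≤ lf T (X.erase u) v + 1})
    (fun X u => {v ∈ X.erase u | lf T X v < m}) ?_ ?_ ?_
  · intro X hX u hu z hz
    have hzl := h.notMem_Lv_of_mem_Sj hX (by omega) hu hz
    obtain ⟨h1, h2, h3, h4, h5, -, -⟩ := h.facts hX (Sj_subset_Lv _ _ hu) hz
    have hzm := hz.le_lf_of_mem_Sj hu
    refine ⟨fun b p hb _ hbS => Finset.mem_filter.2 ⟨hb.mem, hb.new_mem_Sj.1 hbS⟩, ?_⟩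
    refine (hz.sum_xt_le h1 (Finset.filter_subset _ _)).trans (Nat.add_le_add_right ?_ 1)
    refine Finset.sum_le_sum_of_subset fun v hv => ?_
    obtain ⟨hv, hle⟩ := Finset.mem_filter.1 hv
    refine Finset.mem_filter.2 ⟨Finset.mem_of_mem_erase hv, ?_⟩
    by_cases hvz : v = z
    · subst hvz; omega
    · rw [← h5 v hv hvz hzl] at hle
      have := lf_add_lf_le (T := T) (Finset.mem_of_mem_erase hv)
        (Finset.mem_of_mem_erase hz.mem) hvz
      rw [h.leaves hX] at this
      omega
  · intro X hX u hu z hz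
    have hzl := h.notMem_Lv_of_mem_Sj hX (by omega) hu hz
    obtain ⟨h1, h2, h3, h4, h5, -, h7⟩ := h.facts hX (Sj_subset_Lv _ _ hu) hz
    have hzm := hz.le_lf_of_mem_Sj hu
    have hzm' := h.lf_le_of_sj_zero hX hs (Finset.mem_of_mem_erase hz.mem)
    have hsm : ∀ v ∈ X.erase u, v ≠ z → lf T X v + m ≤ ℓ := by
      intro v hv hvz
      have := lf_add_lf_le (T := T) (Finset.mem_of_mem_erase hv)
        (Finset.mem_of_mem_erase hz.mem) hvz
      rw [h.leaves hX] at this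
      omega
    refine ⟨Finset.filter_subset _ _, fun b p hb hp => ?_⟩
    obtain ⟨hpR, hlt⟩ := Finset.mem_filter.1 hp
    have hpz : p ≠ z := by
      rintro rfl
      omega
    have h8 := h5 p hpR hpz hzl
    have h9 := hsm p hpR hpz
    refine ⟨fun hP => ?_, Finset.mem_sdiff.2 ⟨hb.new_mem_Lv, fun hbS => ?_⟩, ?_⟩
    · have hpos : 0 < s m := by
        rw [← h.sj m hX]
        exact Finset.card_pos.2 ⟨u, hu⟩
      rw [← h.sj m hP] at hpos
      obtain ⟨y, hy⟩ := Finset.card_pos.1 hpos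
      obtain ⟨-, v, hv, -, hmv⟩ := Finset.mem_filter.1 hy
      rcases Finset.mem_insert.1 hv with rfl | hv
      · rw [hb.lf_new] at hmv
        omega
      · by_cases hvp : v = p
        · subst hvp
          rw [hb.lf_parent] at hmv
          omega
        · have h10 := hb.lf_le hv hvp
          by_cases hvz : v = z
          · subst hvz; omega
          · have := h5 v hv hvz hzl
            have := hsm v hv hvz
            omega
    · have := hb.new_mem_Sj.1 hbS
      omega
    · have h10 := hb.card_Lv_le
      have h11 := hb.lf_le_add_one z
      have h12 : {y ∈ Lv T (insert b (X.erase u)) | T.Adj z y}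
          ⊆ Sj T (m - 2) (insert b (X.erase u)) := fun y hy =>
        Finset.mem_filter.2 ⟨(Finset.mem_filter.1 hy).1, z, Finset.mem_insert_of_mem hz.mem,
          (Finset.mem_filter.1 hy).2, by omega⟩
      have h13 := Finset.card_le_card h12
      rw [Finset.card_sdiff_of_subset (Sj_subset_Lv _ _)]
      unfold lf dg at h11 h3
      unfold lf dg at hzm
      omega
  · intro X hX
    have hpos : 0 < m := by omega
    have h1 : ∀ u ∈ Sj T m X, ∑ v ∈ X with lf T X v < m, xt T X v
        = ∑ v ∈ X.erase u with lf T X v < m, xt T X v + xt T X u := by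
      intro u hu
      have hu' := Sj_subset_Lv _ _ hu
      rw [Finset.filter_erase, Finset.sum_erase_add]
      refine Finset.mem_filter.2 ⟨(mem_Lv.1 hu').1, ?_⟩
      rwa [h.lf_leaf hX hu']
    have h2 := Finset.sum_congr rfl h1
    rw [Finset.sum_add_distrib, Finset.sum_const, h.sj m hX, smul_eq_mul] at h2
    have h3 : ∑ u ∈ Sj T m X, xt T X u ≤ ∑ v ∈ X with lf T X v < m, xt T X v := by
      refine Finset.sum_le_sum_of_subset fun u hu => ?_
      have hu' := Sj_subset_Lv _ _ hu
      refine Finset.mem_filter.2 ⟨(mem_Lv.1 hu').1, ?_⟩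
      rwa [h.lf_leaf hX hu']
    rw [Nat.sub_mul, one_mul]
    omega

lemma charged_heavy_top (h : Model T k ℓ s α w P)
    {𝒮 : Finset (Finset V)} (h𝒮 : ∀ X ∈ 𝒮, P X) {m : ℕ} (hm : 1 ≤ m)
    (hs : s (m + 1) = 0) :
    Charged 𝒮 #(bad T k P) fun X t =>
      (((ℓ - s m) * ∑ v ∈ X with m ≤ lf T X v, xt T X v : ℕ) : ℝ)
        ≤ (ℓ + 1 : ℕ) * t * (∑ v ∈ X with lf T X v < m, xt T X v + 1 : ℕ) := by
  refine h.charged_of_attachments h𝒮 (fun X => Lv T X \ Sj T m X) (fun X => Sj T (m + 1) X)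
    (fun _ _ => Finset.sdiff_subset) (ℓ + 1) (by omega) _ _
    (fun X u => {v ∈ X.erase u | lf T X v < m}) (fun X u => {v ∈ X | m ≤ lf T X v}) ?_ ?_ ?_
  · intro X hX u hu z hz
    obtain ⟨hu, huS⟩ := Finset.mem_sdiff.1 hu
    obtain ⟨h1, h2, h3, h4, h5, -, -⟩ := h.facts hX hu hz
    refine ⟨fun b p hb _ hbS => Finset.mem_filter.2 ⟨hb.mem, ?_⟩, ?_⟩
    · by_contra hp
      have hpz : p ≠ z := by
        rintro rfl
        exact huS (Finset.mem_filter.2 ⟨hu, p, Finset.mem_of_mem_erase hz.mem, hz.adj,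
          not_lt.1 hp⟩)
      have := h4 p hb.mem hpz
      exact (Finset.mem_sdiff.1 hbS).2 (hb.new_mem_Sj.2 (by omega))
    · refine (hz.sum_xt_le h1 (Finset.filter_subset _ _)).trans (Nat.add_le_add_right ?_ 1)
      exact Finset.sum_le_sum_of_subset (Finset.filter_subset_filter _ (Finset.erase_subset _ _))
  · intro X hX u hu z hz
    obtain ⟨hu, huS⟩ := Finset.mem_sdiff.1 hu
    obtain ⟨h1, h2, h3, h4, h5, -, h7⟩ := h.facts hX hu hz
    have hsub : {v ∈ X | m ≤ lf T X v} ⊆ X.erase u := by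
      intro v hv
      simp only [Finset.mem_filter] at hv
      refine Finset.mem_erase.2 ⟨?_, hv.1⟩
      rintro rfl
      omega
    refine ⟨hsub, fun b p hb hp => ?_⟩
    have hpR := hsub hp
    obtain ⟨hpX, hpm⟩ := Finset.mem_filter.1 hp
    have hpz : p ≠ z := by
      rintro rfl
      exact huS (Finset.mem_filter.2 ⟨hu, p, hpX, hz.adj, hpm⟩)
    have h8 := h4 p hpR hpz
    refine ⟨fun hP => ?_, hb.new_mem_Sj.2 (by omega), ?_⟩
    · have := h.lf_le_of_sj_zero hP hs (Finset.mem_insert_of_mem hpR)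
      rw [hb.lf_parent] at this
      omega
    · have h9 := hb.card_Lv_le
      have h10 := Finset.card_le_card (Sj_subset_Lv (T := T) (m + 1) (insert b (X.erase u)))
      omega
  · intro X hX
    rw [Finset.sum_const, smul_eq_mul, Finset.card_sdiff_of_subset (Sj_subset_Lv _ _),
      h.leaves hX, h.sj m hX]

end Model

/-- The sum of the distances from `x` to the members of `X`. -/
noncomputable def distSum (T : SimpleGraph V) (X : Finset V) (x : V) : ℕ := ∑ y ∈ X, T.dist x y

lemma wiener_insert {R : Finset V} {b : V} (hb : b ∉ R) :
    wiener T (insert b R) = wiener T R + 2 * distSum T R b := by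
  unfold wiener distSum
  rw [Finset.sum_insert hb, Finset.sum_insert hb, dist_self, zero_add,
    Finset.sum_congr rfl fun x _ => Finset.sum_insert (f := fun y => T.dist x y) hb,
    Finset.sum_add_distrib, Finset.sum_congr rfl fun x _ => dist_comm (u := x) (v := b)]
  ring

lemma Att.distSum_eq {R : Finset V} {b p : V} (h : Att T R b p) :
    distSum T R b = distSum T R p + #R := by
  unfold distSum
  rw [Finset.card_eq_sum_ones, ← Finset.sum_add_distrib]
  exact Finset.sum_congr rfl fun y hy => dist_extension h.tree h.conn h.notMem h.mem h.adj hy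

lemma distSum_erase {X : Finset V} {u : V} (hu : u ∈ X) (x : V) :
    distSum T (X.erase u) x + T.dist x u = distSum T X x :=
  Finset.sum_erase_add _ _ hu

namespace Model

variable {k ℓ : ℕ} {s : ℕ → ℕ} {α w : ℕ} {P : Finset V → Prop}

lemma distSum_add_dist (h : Model T k ℓ s α w P) {X : Finset V} (hX : P X) {u p b : V} (hu : u ∈ X)
    (hb : Att T (X.erase u) b p) (hP : P (insert b (X.erase u))) :
    distSum T X u + T.dist u p = distSum T X p + (k - 1) := by
  have h1 := wiener_insert (T := T) hb.notMem
  have h2 := wiener_insert (T := T) (Finset.notMem_erase u X)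
  rw [Finset.insert_erase hu, h.wien hX] at h2
  rw [h.wien hP, hb.distSum_eq, Finset.card_erase_of_mem hu, h.card hX] at h1
  have h3 := distSum_erase (T := T) hu u
  have h4 := distSum_erase (T := T) hu p
  rw [dist_self] at h3
  rw [dist_comm] at h4
  omega

lemma dist_leaves_lt (h : Model T k ℓ s α w P)
    {X : Finset V} (hX : P X) {u v : V} (hu : u ∈ Lv T X) (hv : v ∈ Lv T X) :
    T.dist u v + 1 < k := by
  have h1 : 0 < #(((Lv T X).erase u).erase v) := by
    have h2 := Finset.pred_card_le_card_erase (s := Lv T X) (a := u)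
    have h3 := Finset.pred_card_le_card_erase (s := (Lv T X).erase u) (a := v)
    have h4 := h.three_le
    rw [h.leaves hX] at h2
    omega
  obtain ⟨y, hy⟩ := Finset.card_pos.1 h1
  obtain ⟨hyv, hy⟩ := Finset.mem_erase.1 hy
  obtain ⟨hyu, hy⟩ := Finset.mem_erase.1 hy
  have h5 := dist_lt_card h.tree (conn_erase (h.conn hX) (mem_Lv.1 hy).2
      (by linarith [h.three_le_card hX]))
    (Finset.mem_erase.2 ⟨Ne.symm hyu, (mem_Lv.1 hu).1⟩)
    (Finset.mem_erase.2 ⟨Ne.symm hyv, (mem_Lv.1 hv).1⟩)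
  rw [Finset.card_erase_of_mem (mem_Lv.1 hy).1, h.card hX] at h5
  omega

lemma charged_wiener (h : Model T k ℓ s α w P) {𝒮 : Finset (Finset V)} (h𝒮 : ∀ X ∈ 𝒮, P X) :
    Charged 𝒮 #(bad T k P) fun X t =>
      ((#{v ∈ Lv T X | 1 ≤ xt T X v}.offDiag / 2 : ℕ) : ℝ)
        ≤ (ℓ + 1 : ℕ) * t * (ex T X + 1 : ℕ) := by
  set N : Finset V → V → V → Prop := fun X u q =>
    distSum T X u + T.dist u q ≠ distSum T X q + (k - 1) with hN
  refine h.charged_of_attachments h𝒮 (fun X => Lv T X) (fun X => Lv T X)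
    (fun _ _ => subset_rfl) (ℓ + 1) (by omega) _ _ (fun X u => X.erase u)
    (fun X u => {q ∈ Lv T X | q ≠ u ∧ N X u q}) ?_ ?_ ?_
  · intro X hX u hu z hz
    exact ⟨fun b p hb _ _ => hb.mem, (h.facts hX hu hz).2.2.2.2.2.1⟩
  · intro X hX u hu z hz
    obtain ⟨h1, h2, h3, h4, h5, -, h7⟩ := h.facts hX hu hz
    refine ⟨fun v hv => ?_, fun b p hb hp => ⟨fun hP => ?_, hb.new_mem_Lv, ?_⟩⟩
    · obtain ⟨hv, hvu, -⟩ := Finset.mem_filter.1 hv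
      exact Finset.mem_erase.2 ⟨hvu, (mem_Lv.1 hv).1⟩
    · exact (Finset.mem_filter.1 hp).2.2 (h.distSum_add_dist hX h1 hb hP)
    · have := hb.card_Lv_le
      omega
  · intro X hX
    set Q : Finset V := {v ∈ Lv T X | 1 ≤ xt T X v} with hQ
    have hle : #Q.offDiag ≤ 2 * ∑ c ∈ Q.offDiag, if N X c.1 c.2 then 1 else 0 := by
      have hswap : ∑ c ∈ Q.offDiag, (if N X c.2 c.1 then 1 else 0)
          = ∑ c ∈ Q.offDiag, if N X c.1 c.2 then 1 else 0 := by
        refine Finset.sum_nbij' Prod.swap Prod.swap ?_ ?_ ?_ ?_ ?_ <;>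
          simp +contextual [Finset.mem_offDiag, eq_comm]
      rw [two_mul]
      nth_rewrite 2 [← hswap]
      rw [← Finset.sum_add_distrib, Finset.card_eq_sum_ones]
      refine Finset.sum_le_sum fun c hc => ?_
      obtain ⟨hc1, hc2, -⟩ := Finset.mem_offDiag.1 hc
      have := h.dist_leaves_lt hX (Finset.mem_filter.1 hc1).1 (Finset.mem_filter.1 hc2).1
      by_cases n1 : N X c.1 c.2
      · simp [n1]
      · by_cases n2 : N X c.2 c.1
        · simp [n2]
        · exfalso
          simp only [hN, not_not] at n1 n2
          rw [dist_comm] at n2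
          omega
    have h2 : ∑ c ∈ Q.offDiag, (if N X c.1 c.2 then 1 else 0)
        ≤ ∑ u ∈ Lv T X, ∑ v ∈ Lv T X with v ≠ u ∧ N X u v, xt T X v := by
      have e1 : Q.offDiag = {c ∈ Q ×ˢ Q | c.2 ≠ c.1} := by
        ext c
        simp [Finset.mem_offDiag, and_assoc, eq_comm]
      rw [e1, Finset.sum_filter, Finset.sum_product]
      refine (Finset.sum_le_sum_of_subset (Finset.filter_subset _ _)).trans
        (Finset.sum_le_sum fun u _ => ?_)
      rw [Finset.sum_filter (s := Lv T X) (p := fun v => v ≠ u ∧ N X u v)]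
      refine (Finset.sum_le_sum fun v hv => ?_).trans
        (Finset.sum_le_sum_of_subset (Finset.filter_subset _ _))
      have hv1 := (Finset.mem_filter.1 hv).2
      by_cases hvu : v = u
      · simp [hvu]
      · by_cases hn : N X u v <;> simp [hvu, hn]
        exact hv1
    omega

lemma pair_facts (h : Model T k ℓ s α w P)
    {X : Finset V} (hX : P X) {u₁ u₂ : V} (h₁ : u₁ ∈ Lv T X) (h₂ : u₂ ∈ Lv T X)
    (hne : u₁ ≠ u₂) : ∃ z₁ z₂, Att T (X.erase u₁) u₁ z₁ ∧
      Att T ((X.erase u₁).erase u₂) u₂ z₂ ∧ z₁ ∈ (X.erase u₁).erase u₂ ∧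
      insert u₁ (insert u₂ ((X.erase u₁).erase u₂)) = X ∧ u₂ ∈ X.erase u₁ := by
  have hu₁ := (mem_Lv.1 h₁).1
  obtain ⟨z₁, hz₁⟩ := exists_att h.tree (h.conn hX) (h.three_le_card hX) h₁
  have h3 : u₂ ∈ Lv T (X.erase u₁) :=
    hz₁.mem_Lv_of_mem_insert (by rwa [Finset.insert_erase hu₁]) hne.symm
  have hc : 3 ≤ #(X.erase u₁) := by
    rw [Finset.card_erase_of_mem hu₁, h.card hX]
    have := h.five_le
    omega
  obtain ⟨z₂, hz₂⟩ := exists_att h.tree hz₁.conn hc h3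
  refine ⟨z₁, z₂, hz₁, hz₂, Finset.mem_erase.2 ⟨?_, hz₁.mem⟩, ?_, (mem_Lv.1 h3).1⟩
  · rintro rfl
    exact (hz₁.erase_facts hu₁).2.2.2.2.2 h₂
  · rw [Finset.insert_erase (mem_Lv.1 h3).1, Finset.insert_erase hu₁]

lemma card_pair_fiber (h : Model T k ℓ s α w P)
    {𝒮 : Finset (Finset V)} (h𝒮 : ∀ X ∈ 𝒮, P X) {X : Finset V} (hX : P X)
    {u₁ u₂ : V} (h₁ : u₁ ∈ Lv T X) (h₂ : u₂ ∈ Lv T X) (hne : u₁ ≠ u₂) :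
    #{c ∈ 𝒮.sigma fun Y => (Lv T Y).offDiag |
      (c.1.erase c.2.1).erase c.2.2 = (X.erase u₁).erase u₂} ≤ (ex T X + 2) ^ 2 := by
  obtain ⟨z₁, z₂, hz₁, hz₂, -, hXeq, hu₂⟩ := h.pair_facts hX h₁ h₂ hne
  set R := (X.erase u₁).erase u₂ with hR
  have hex : ex T R ≤ ex T X + 2 := by
    have e1 := (hz₁.erase_facts (mem_Lv.1 h₁).1).2.2.2.2.1
    have e2 := (hz₂.erase_facts hu₂).2.2.2.2.1
    rw [← hR] at e2
    omega
  have hcard : #(outer T R R ×ˢ outer T R R) ≤ (ex T X + 2) ^ 2 := by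
    rw [Finset.card_product, sq]
    have := (card_outer_le (T := T) R R).trans hex
    exact Nat.mul_le_mul this this
  have hY : ∀ Y y₁ y₂, Y ∈ 𝒮 → (y₁, y₂) ∈ (Lv T Y).offDiag → (Y.erase y₁).erase y₂ = R →
      y₁ ∈ outer T R R ∧ y₂ ∈ outer T R R ∧ Y = insert y₁ (insert y₂ R) := by
    intro Y y₁ y₂ hY hy he
    obtain ⟨hy₁, hy₂, hyne⟩ := Finset.mem_offDiag.1 hy
    obtain ⟨t₁, t₂, ht₁, ht₂, htR, hYeq, hy₂'⟩ := h.pair_facts (h𝒮 Y hY) hy₁ hy₂ hyne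
    rw [he] at ht₂ htR hYeq
    refine ⟨mem_outer.2 ⟨fun hc => ?_, t₁, htR, ht₁.adj⟩,
      mem_outer.2 ⟨ht₂.notMem, t₂, ht₂.mem, ht₂.adj⟩, hYeq.symm⟩
    rw [← he] at hc
    exact ht₁.notMem (Finset.mem_of_mem_erase hc)
  refine le_trans ?_ hcard
  refine Finset.card_le_card_of_injOn (fun c => c.2) ?_ ?_
  · rintro ⟨Y, y₁, y₂⟩ hc
    obtain ⟨hc, he⟩ := Finset.mem_filter.1 (Finset.mem_coe.1 hc)
    obtain ⟨hc, hy⟩ := Finset.mem_sigma.1 hc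
    obtain ⟨a1, a2, -⟩ := hY Y y₁ y₂ hc hy he
    exact Finset.mem_coe.2 (Finset.mem_product.2 ⟨a1, a2⟩)
  · rintro ⟨Y, y₁, y₂⟩ hc ⟨Y', y₁', y₂'⟩ hc' heq
    obtain ⟨hc, he⟩ := Finset.mem_filter.1 (Finset.mem_coe.1 hc)
    obtain ⟨hc, hy⟩ := Finset.mem_sigma.1 hc
    obtain ⟨hc', he'⟩ := Finset.mem_filter.1 (Finset.mem_coe.1 hc')
    obtain ⟨hc', hy'⟩ := Finset.mem_sigma.1 hc'
    simp only at heq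
    rw [Prod.mk.injEq] at heq
    obtain ⟨rfl, rfl⟩ := heq
    obtain ⟨-, -, a3⟩ := hY Y y₁ y₂ hc hy he
    obtain ⟨-, -, a3'⟩ := hY Y' y₁ y₂ hc' hy' he'
    rw [a3, a3']

lemma mem_bad_of_pair (h : Model T k ℓ s α w P)
    {X : Finset V} (hX : P X) {m : ℕ} (hs : s (m + 1) = 0)
    {u₁ u₂ b₁ b₂ v : V} (h₁ : u₁ ∈ Lv T X) (h₂ : u₂ ∈ Lv T X) (hne : u₁ ≠ u₂)
    (hv : v ∈ X) (hm : m ≤ lf T X v + 1) (hv₁ : v ≠ u₁) (ha₁ : ¬ T.Adj v u₁)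
    (hv₂ : v ≠ u₂) (ha₂ : ¬ T.Adj v u₂) (hb₁ : b₁ ∉ X) (hb₂ : b₂ ∉ X) (hb : b₁ ≠ b₂)
    (hvb₁ : T.Adj v b₁) (hvb₂ : T.Adj v b₂) :
    insert b₁ (insert b₂ ((X.erase u₁).erase u₂)) ∈ bad T k P ∧
    b₁ ∈ Sj T (m + 1) (insert b₁ (insert b₂ ((X.erase u₁).erase u₂))) ∧
    b₂ ∈ Sj T (m + 1) (insert b₁ (insert b₂ ((X.erase u₁).erase u₂))) ∧
    #(Sj T (m + 1) (insert b₁ (insert b₂ ((X.erase u₁).erase u₂)))) ≤ 4 * (m + 1) := by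
  obtain ⟨z₁, z₂, hz₁, hz₂, -, hXeq, hu₂⟩ := h.pair_facts hX h₁ h₂ hne
  have f₁ := hz₁.erase_facts (mem_Lv.1 h₁).1
  have f₂ := hz₂.erase_facts hu₂
  set R := (X.erase u₁).erase u₂ with hR
  have hvX' : v ∈ X.erase u₁ := Finset.mem_erase.2 ⟨hv₁, hv⟩
  have hvR : v ∈ R := Finset.mem_erase.2 ⟨hv₂, hvX'⟩
  have hRX : R ⊆ X := (Finset.erase_subset _ _).trans (Finset.erase_subset _ _)
  have t₂ : Att T R b₂ v := hz₂.of (fun e => hb₂ (hRX e)) hvR hvb₂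
  have hb₁' : b₁ ∉ insert b₂ R := by
    rw [Finset.mem_insert]
    rintro (e | e)
    · exact hb e
    · exact hb₁ (hRX e)
  have t₁ : Att T (insert b₂ R) b₁ v :=
    ⟨h.tree, t₂.conn_insert, by rw [t₂.card_insert]; linarith [t₂.two_le], hb₁',
      Finset.mem_insert_of_mem hvR, hvb₁⟩
  have hl1 := f₁.2.2.1 v hvX' (by rintro rfl; exact ha₁ hz₁.adj)
  have hl2 := f₂.2.2.1 v hvR (by rintro rfl; exact ha₂ hz₂.adj)
  have hl3 := t₂.lf_parent
  have hl4 := t₁.lf_parent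
  have hb₂S : b₂ ∈ Sj T (m + 1) (insert b₁ (insert b₂ R)) :=
    Finset.mem_filter.2 ⟨t₁.mem_Lv_of_mem t₂.new_mem_Lv t₂.ne, v,
      Finset.mem_insert_of_mem (Finset.mem_insert_of_mem hvR), hvb₂, by omega⟩
  refine ⟨Finset.mem_filter.2 ⟨Finset.mem_univ _, ?_, t₁.conn_insert, fun hP => ?_⟩,
    t₁.new_mem_Sj.2 (by omega), hb₂S, ?_⟩
  · rw [t₁.card_insert, t₂.card_insert, ← hz₂.card_insert, ← h.card hX, Finset.insert_erase hu₂,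
      Finset.card_erase_add_one (mem_Lv.1 h₁).1]
  · have := h.lf_le_of_sj_zero hP hs
      (Finset.mem_insert_of_mem (Finset.mem_insert_of_mem hvR))
    omega
  · have c1 := t₁.card_Sj_le (j := m + 1) (by omega)
    have c2 := t₂.card_Sj_le (j := m + 1) (by omega)
    have c3 := hz₂.card_Sj_remove_le (j := m + 1) (by omega)
    have c4 := hz₁.card_Sj_remove_le (j := m + 1) (by omega)
    rw [f₂.1] at c3
    rw [f₁.1, h.sj _ hX, hs] at c4
    omega

lemma charged_pairs (h : Model T k ℓ s α w P) {𝒮 : Finset (Finset V)} (h𝒮 : ∀ X ∈ 𝒮, P X) {m : ℕ}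
    (hs : s (m + 1) = 0) (A : Finset V → Finset V) (M : ℕ)
    (hA : ∀ X, P X → ∀ v ∈ A X, v ∈ X ∧ m ≤ lf T X v + 1 ∧
      M ≤ #{u ∈ Lv T X | v ≠ u ∧ ¬ T.Adj v u}) :
    Charged 𝒮 #(bad T k P) fun X t =>
      ((M * (M - 1) * ∑ v ∈ A X, xt T X v * (xt T X v - 1) : ℕ) : ℝ)
        ≤ ((4 * (m + 1)) ^ 2 : ℕ) * t * ((ex T X + 2) ^ 2 : ℕ) := by
  refine (charged_of_fibers 𝒮 (bad T k P) (fun X => (Lv T X).offDiag)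
    (fun X => (capped (4 * (m + 1)) (Sj T (m + 1) X)).offDiag)
    (fun X c => (X.erase c.1).erase c.2) ((4 * (m + 1)) ^ 2) (by positivity) ?_
    (fun X c => ((∑ v ∈ A X with (v ≠ c.1 ∧ ¬ T.Adj v c.1) ∧ (v ≠ c.2 ∧ ¬ T.Adj v c.2),
      xt T X v * (xt T X v - 1) : ℕ) : ℝ)) (fun X => ((ex T X + 2) ^ 2 : ℕ)) ?_ ?_).mono ?_
  · intro X _
    rw [Finset.offDiag_card, sq]
    have := card_capped_le (4 * (m + 1)) (Sj T (m + 1) X)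
    exact (Nat.sub_le _ _).trans (Nat.mul_le_mul this this)
  · rintro X hX ⟨u₁, u₂⟩ hu
    obtain ⟨h₁, h₂, hne⟩ := Finset.mem_offDiag.1 hu
    exact Nat.cast_le.2 (h.card_pair_fiber h𝒮 (h𝒮 X hX) h₁ h₂ hne)
  · rintro X hX ⟨u₁, u₂⟩ hu
    have hPX := h𝒮 X hX
    obtain ⟨h₁, h₂, hne⟩ := Finset.mem_offDiag.1 hu
    simp only at h₁ h₂ hne
    refine Nat.cast_le.2 ?_
    set B : Finset V := {v ∈ A X | (v ≠ u₁ ∧ ¬ T.Adj v u₁) ∧ (v ≠ u₂ ∧ ¬ T.Adj v u₂)} with hB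
    set nb : V → Finset V := fun v => {b | b ∉ X ∧ T.Adj v b} with hnb
    have hcount : #(B.biUnion fun v => (nb v).offDiag)
        = ∑ v ∈ B, xt T X v * (xt T X v - 1) := by
      rw [Finset.card_biUnion]
      · refine Finset.sum_congr rfl fun v _ => ?_
        rw [Finset.offDiag_card, Nat.mul_sub, mul_one]
        rfl
      · intro v hv y hy hvy
        rw [Function.onFun, Finset.disjoint_left]
        rintro ⟨c, d⟩ hc hc'
        have m1 := (Finset.mem_filter.1 (Finset.mem_offDiag.1 hc).1).2
        have m2 := (Finset.mem_filter.1 (Finset.mem_offDiag.1 hc').1).2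
        exact hvy (eq_of_adj_of_notMem h.tree (h.conn hPX) m1.1
          (hA X hPX v (Finset.mem_filter.1 hv).1).1 (hA X hPX y (Finset.mem_filter.1 hy).1).1
          m1.2 m2.2)
    rw [← hcount]
    refine Finset.card_le_card_of_injOn
      (fun c => ⟨insert c.1 (insert c.2 ((X.erase u₁).erase u₂)), c⟩) ?_ ?_
    · rintro ⟨b₁, b₂⟩ hb
      obtain ⟨v, hv, hb⟩ := Finset.mem_biUnion.1 (Finset.mem_coe.1 hb)
      obtain ⟨hb₁, hb₂, hbne⟩ := Finset.mem_offDiag.1 hb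
      have m1 := (Finset.mem_filter.1 hb₁).2
      have m2 := (Finset.mem_filter.1 hb₂).2
      obtain ⟨hvA, ⟨hv₁, ha₁⟩, hv₂, ha₂⟩ := Finset.mem_filter.1 hv
      obtain ⟨hvX, hvm, -⟩ := hA X hPX v hvA
      obtain ⟨q1, q2, q3, q4⟩ := h.mem_bad_of_pair hPX hs h₁ h₂ hne hvX hvm hv₁ ha₁ hv₂ ha₂
        m1.1 m2.1 hbne m1.2 m2.2
      refine Finset.mem_coe.2 (Finset.mem_filter.2 ⟨Finset.mem_sigma.2 ⟨q1,
        Finset.mem_offDiag.2 ⟨mem_capped q4 q2, mem_capped q4 q3, hbne⟩⟩, ?_⟩)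
      have hRX : (X.erase u₁).erase u₂ ⊆ X :=
        (Finset.erase_subset _ _).trans (Finset.erase_subset _ _)
      simp only
      rw [Finset.erase_insert, Finset.erase_insert]
      · exact fun e => m2.1 (hRX e)
      · rw [Finset.mem_insert]
        rintro (e | e)
        · exact hbne e
        · exact m1.1 (hRX e)
    · intro c _ c' _ e
      exact congrArg (fun c : (Σ _ : Finset V, V × V) => c.2) e
  · intro X hX t _ hle
    have hPX := h𝒮 X hX
    refine le_trans ?_ hle
    rw [← Nat.cast_sum]
    refine Nat.cast_le.2 ?_
    rw [sum_filter_swap (Lv T X).offDiag (A X)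
      fun v c => (v ≠ c.1 ∧ ¬ T.Adj v c.1) ∧ (v ≠ c.2 ∧ ¬ T.Adj v c.2), Finset.mul_sum]
    refine Finset.sum_le_sum fun v hv => ?_
    rw [mul_comm]
    refine Nat.mul_le_mul_left _ ?_
    have hM := (hA X hPX v hv).2.2
    have hsub : ({u ∈ Lv T X | v ≠ u ∧ ¬ T.Adj v u} : Finset V).offDiag ⊆
        {c ∈ (Lv T X).offDiag |
          (v ≠ c.1 ∧ ¬ T.Adj v c.1) ∧ (v ≠ c.2 ∧ ¬ T.Adj v c.2)} := by
      intro c hc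
      obtain ⟨c1, c2, c3⟩ := Finset.mem_offDiag.1 hc
      obtain ⟨c1, c1'⟩ := Finset.mem_filter.1 c1
      obtain ⟨c2, c2'⟩ := Finset.mem_filter.1 c2
      exact Finset.mem_filter.2 ⟨Finset.mem_offDiag.2 ⟨c1, c2, c3⟩, c1', c2'⟩
    refine le_trans ?_ (Finset.card_le_card hsub)
    rw [Finset.offDiag_card]
    calc M * (M - 1) ≤ #{u ∈ Lv T X | v ≠ u ∧ ¬ T.Adj v u}
          * (#{u ∈ Lv T X | v ≠ u ∧ ¬ T.Adj v u} - 1) :=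
          Nat.mul_le_mul hM (Nat.sub_le_sub_right hM 1)
      _ = _ := by rw [Nat.mul_sub, mul_one]

end Model

lemma Charged.and {ι : Type*} {𝒮 : Finset ι} {N N' : ℝ} {Q Q' : ι → ℝ → Prop}
    (h : Charged 𝒮 N Q) (h' : Charged 𝒮 N' Q') (hQ : ∀ X, Monotone (Q X))
    (hQ' : ∀ X, Monotone (Q' X)) : Charged 𝒮 (N + N') fun X t => Q X t ∧ Q' X t := by
  obtain ⟨Φ, h0, h1, h2⟩ := h
  obtain ⟨Ψ, k0, k1, k2⟩ := h'
  refine ⟨fun X => Φ X + Ψ X, fun X => add_nonneg (h0 X) (k0 X), ?_, fun X hX => ⟨?_, ?_⟩⟩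
  · rw [Finset.sum_add_distrib]
    exact add_le_add h1 k1
  · exact hQ X (le_add_of_nonneg_right (k0 X)) (h2 X hX)
  · exact hQ' X (le_add_of_nonneg_left (h0 X)) (k2 X hX)

lemma monotone_flow (a r φ : ℕ) : Monotone fun t : ℝ => (a : ℝ) ≤ r * t * φ := by
  intro t t' htt hle
  refine le_trans hle ?_
  gcongr

lemma monotone_and {q q' : ℝ → Prop} (h : Monotone q) (h' : Monotone q') :
    Monotone fun t => q t ∧ q' t := fun _ _ htt hq => ⟨h htt hq.1, h' htt hq.2⟩

lemma exists_rare [Nonempty V] (𝒦 : Finset (Finset V)) (k : ℕ) (h𝒦 : ∀ X ∈ 𝒦, #X = k) :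
    ∃ r : V, #{X ∈ 𝒦 | r ∈ X} * Fintype.card V ≤ k * #𝒦 := by
  by_contra! hcon
  have h1 : ∑ r : V, #{X ∈ 𝒦 | r ∈ X} = k * #𝒦 := by
    simp_rw [Finset.card_filter]
    rw [Finset.sum_comm]
    have : ∀ X ∈ 𝒦, ∑ r : V, (if r ∈ X then 1 else 0) = k := by
      intro X hX
      rw [← h𝒦 X hX, ← Finset.card_filter, Finset.filter_univ_mem]
    rw [Finset.sum_congr rfl this, Finset.sum_const, smul_eq_mul, mul_comm]
  have h2 : ∑ r : V, k * #𝒦 < ∑ r : V, #{X ∈ 𝒦 | r ∈ X} * Fintype.card V :=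
    Finset.sum_lt_sum_of_nonempty Finset.univ_nonempty fun r _ => hcon r
  rw [Finset.sum_const, ← Finset.sum_mul, h1, Finset.card_univ, smul_eq_mul, mul_comm] at h2
  exact lt_irrefl _ h2

lemma Model.exists_typical {k ℓ : ℕ} {s : ℕ → ℕ} {α w : ℕ} {P : Finset V → Prop}
    (h : Model T k ℓ s α w P) (hV : k * 10 ^ 36 ≤ Fintype.card V)
    (hbad : (10 : ℝ) ^ 35 * #(bad T k P) < #(subtrees T k)) {Q : Finset V → ℝ → Prop}
    (hQ : ∀ X, Monotone (Q X))
    (hc : ∀ 𝒮 : Finset (Finset V), (∀ X ∈ 𝒮, P X) → Charged 𝒮 (5 * #(bad T k P)) Q) :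
    ∃ X, P X ∧ (ℓ : ℝ) ≤ 11 / 10 * (ex T X + 1) ∧ Q X (1 / 10 ^ 30) := by
  have hk := h.five_le
  have : Nonempty V := Fintype.card_pos_iff.1 (by omega)
  obtain ⟨r, hr⟩ := exists_rare (subtrees T k) k fun X hX => (Finset.mem_filter.1 hX).2.1
  set 𝒮 : Finset (Finset V) := {X ∈ subtrees T k | P X ∧ r ∉ X} with h𝒮def
  have h𝒮 : ∀ X ∈ 𝒮, P X := fun X hX => (Finset.mem_filter.1 hX).2.1
  have hr𝒮 : ∀ X ∈ 𝒮, r ∉ X := fun X hX => (Finset.mem_filter.1 hX).2.2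
  have hcover : subtrees T k ⊆ bad T k P ∪ {X ∈ subtrees T k | r ∈ X} ∪ 𝒮 := by
    intro X hX
    obtain ⟨-, h1, h2⟩ := Finset.mem_filter.1 hX
    by_cases hP : P X
    · by_cases hrX : r ∈ X
      · exact Finset.mem_union_left _ (Finset.mem_union_right _ (Finset.mem_filter.2 ⟨hX, hrX⟩))
      · exact Finset.mem_union_right _ (Finset.mem_filter.2 ⟨hX, hP, hrX⟩)
    · exact Finset.mem_union_left _ (Finset.mem_union_left _
        (Finset.mem_filter.2 ⟨Finset.mem_univ _, h1, h2, hP⟩))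
  have hle : #(subtrees T k) ≤ #(bad T k P) + #{X ∈ subtrees T k | r ∈ X} + #𝒮 :=
    (Finset.card_le_card hcover).trans ((Finset.card_union_le _ _).trans
      (Nat.add_le_add_right (Finset.card_union_le _ _) _))
  have hr' : #{X ∈ subtrees T k | r ∈ X} * 10 ^ 36 ≤ #(subtrees T k) := by
    refine Nat.le_of_mul_le_mul_left (c := k) ?_ (by omega)
    calc k * (#{X ∈ subtrees T k | r ∈ X} * 10 ^ 36)
        = #{X ∈ subtrees T k | r ∈ X} * (k * 10 ^ 36) := by ring
      _ ≤ #{X ∈ subtrees T k | r ∈ X} * Fintype.card V := Nat.mul_le_mul_left _ hV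
      _ ≤ _ := hr
  have hle' : (#(subtrees T k) : ℝ)
      ≤ #(bad T k P) + #{X ∈ subtrees T k | r ∈ X} + #𝒮 := by exact_mod_cast hle
  have hr'' : (#{X ∈ subtrees T k | r ∈ X} : ℝ) * 10 ^ 36 ≤ #(subtrees T k) := by
    exact_mod_cast hr'
  have hb0 : (0 : ℝ) ≤ #(bad T k P) := Nat.cast_nonneg _
  obtain ⟨X, hX, ⟨t, ht0, ht1, ht⟩, h2⟩ := exists_of_charged (κ := Unit) (K := 1 / 10)
    (η := 1 / 10 ^ 32) (by norm_num) (h.charged_towards h𝒮 r hr𝒮) (fun _ => hc 𝒮 h𝒮) (by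
      rw [Fintype.card_unit]
      norm_num
      norm_num at hbad hr''
      linarith)
  obtain ⟨t', -, ht', hQt⟩ := h2 ()
  refine ⟨X, h𝒮 X hX, ?_, hQ X (ht'.trans (by norm_num)) hQt⟩
  refine ht.trans ?_
  push_cast
  exact mul_le_mul_of_nonneg_right (ht1.trans (by norm_num)) (by positivity)

/-- Deviations of the excess from its main part are negligible. -/
lemma main_part_large {ω e D Y Z F ℓ : ℝ} (hω0 : 0 ≤ ω) (hω : ω ≤ 1 / 10 ^ 30) (he : 2 ≤ e)
    (hsum : e = D + Y + Z) (hD : 0 ≤ D) (hY : 0 ≤ Y) (hZ : 0 ≤ Z) (hF : 0 < F) (hFℓ : F ≤ ℓ)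
    (hℓ : ℓ ≤ 2 * e * F) (h1 : ℓ * Z ≤ 45 * F * (ω * e))
    (h2 : F * D ≤ 3 * ℓ * ω * (Y + Z + 1)) (h3 : 4 * F < ℓ → ℓ * Y ≤ 15 * F * (ω * e)) :
    99 / 100 * e ≤ Y := by
  have hωe : ω * e ≤ 1 / 10 ^ 30 * e := mul_le_mul_of_nonneg_right hω (by linarith)
  have hZ' : Z ≤ 45 * (ω * e) := by
    refine le_of_mul_le_mul_left ?_ hF
    nlinarith
  by_cases hcase : 4 * F < ℓ
  · exfalso
    have h3 := h3 hcase
    have hY' : Y ≤ 15 * (ω * e) := by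
      refine le_of_mul_le_mul_left ?_ hF
      nlinarith
    have hD' : D ≤ 3 * ω * (60 * (ω * e) + 2 * e) := by
      refine le_of_mul_le_mul_left ?_ hF
      have : ℓ * (Y + Z + 1) ≤ F * (60 * (ω * e) + 2 * e) := by nlinarith
      nlinarith [mul_le_mul_of_nonneg_left this hω0]
    have : 3 * ω * (60 * (ω * e) + 2 * e) ≤ 3 * (1 / 10 ^ 30) * (3 * e) := by
      gcongr
      norm_num at hωe
      linarith
    norm_num at this hωe
    linarith
  · have hD' : D ≤ 18 * (ω * e) := by
      refine le_of_mul_le_mul_left ?_ hF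
      have h4 : ℓ * (Y + Z + 1) ≤ 4 * F * (3 / 2 * e) := by
        refine mul_le_mul (not_lt.1 hcase) (by linarith) (by linarith) (by linarith)
      nlinarith [mul_le_mul_of_nonneg_left h4 hω0]
    norm_num at hωe
    linarith

lemma spread_absurd {ω e D Y Z F ℓ m N Q : ℝ} (hω0 : 0 < ω) (hω : ω ≤ 1 / 10 ^ 30) (he : 2 ≤ e)
    (hsum : e = D + Y + Z) (hD : 0 ≤ D) (hY : 0 ≤ Y) (hZ : 0 ≤ Z) (hm : 2 ≤ m)
    (hmℓ : 10 * m ≤ 9 * ℓ) (hmF : m ≤ F) (hFℓ : F ≤ ℓ) (hℓ : 3 ≤ ℓ) (hℓe : ℓ ≤ 2 * e)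
    (hT : (ℓ - m) * Z ≤ 2 * (m + 1) * ω * (e + 1))
    (hL : (F - 1) * D ≤ (ℓ + 1) * ω * (Y + Z + 1))
    (hM : (ℓ - F - (m - 1)) * Y ≤ 3 * F * ω * (e + 1))
    (hQ : 0 ≤ Q) (hP : (ℓ - m + 1) * (ℓ - m) * Q ≤ (4 * (m + 1)) ^ 2 * ω * (e + 2) ^ 2)
    (hC : Y ^ 2 ≤ N * (Q + Y)) (hN : N * (m - 1) ≤ ℓ - F) (hN' : N ≤ 1 ∨ 2 ≤ N) : False := by
  have hF0 : 0 < F := by linarith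
  have hd1 : ℓ / 10 ≤ ℓ - m + 1 := by linarith
  have hd2 : ℓ / 10 ≤ ℓ - m := by linarith
  have hm1 : m + 1 ≤ 3 / 2 * m := by linarith
  have he1 : e + 1 ≤ 3 / 2 * e := by linarith
  have he2 : e + 2 ≤ 2 * e := by linarith
  have hm0 : 0 < m := by linarith
  have he0 : 0 < e := by linarith
  have hℓ0 : 0 < ℓ := by linarith
  have hωe : 0 < ω * e := by positivity
  have hZ' : ℓ * Z ≤ 45 * F * (ω * e) := by
    calc ℓ * Z ≤ 10 * (ℓ - m) * Z := by gcongr; linarith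
      _ = 10 * ((ℓ - m) * Z) := by ring
      _ ≤ 10 * (2 * (m + 1) * ω * (e + 1)) := by linarith
      _ = 20 * ω * ((m + 1) * (e + 1)) := by ring
      _ ≤ 20 * ω * ((3 / 2 * F) * (3 / 2 * e)) := by gcongr; linarith
      _ = _ := by ring
  have hD' : F * D ≤ 3 * ℓ * ω * (Y + Z + 1) := by
    calc F * D ≤ 2 * (F - 1) * D := by gcongr; linarith
      _ = 2 * ((F - 1) * D) := by ring
      _ ≤ 2 * ((ℓ + 1) * ω * (Y + Z + 1)) := by linarith
      _ = (2 * (ℓ + 1)) * ω * (Y + Z + 1) := by ring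
      _ ≤ (3 * ℓ) * ω * (Y + Z + 1) := by gcongr ?_ * _ * _; linarith
  have hR : 3 * F * ω * (e + 1) ≤ 9 / 2 * F * (ω * e) := by
    calc 3 * F * ω * (e + 1) ≤ 3 * F * ω * (3 / 2 * e) := by gcongr
      _ = _ := by ring
  have hFωe : 0 < F * (ω * e) := mul_pos (by linarith) hωe
  have hℓF : ℓ ≤ 2 * e * F := by
    have := mul_le_mul_of_nonneg_left (a := 2 * e) (b := 1) (c := F) (by linarith) (by linarith)
    linarith
  have hY' : 99 / 100 * e ≤ Y := by
    refine main_part_large hω0.le hω he hsum hD hY hZ (by linarith) hFℓ hℓF hZ' hD' ?_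
    intro h4
    have : ℓ * Y ≤ 2 * (ℓ - F - (m - 1)) * Y := by gcongr; linarith
    linarith
  have hd : ℓ - F - (m - 1) ≤ 5 * ℓ * ω := by
    by_contra! hcon
    have h1 : 5 * ℓ * ω * (99 / 100 * e) < (ℓ - F - (m - 1)) * Y :=
      mul_lt_mul_of_pos_of_nonneg' hcon hY' (by positivity) (by
        have : 0 ≤ 5 * ℓ * ω := by positivity
        linarith)
    have h2 : F * (ω * e) ≤ ℓ * (ω * e) := by gcongr
    have h3 : 0 < ℓ * (ω * e) := by positivity
    linarith
  have hN1 : (N - 1) * (m - 1) ≤ 5 * ℓ * ω := by linarith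
  have hQ' : ℓ ^ 2 * Q ≤ 14400 * m ^ 2 * ω * e ^ 2 := by
    calc ℓ ^ 2 * Q = 100 * ((ℓ / 10) * (ℓ / 10) * Q) := by ring
      _ ≤ 100 * ((ℓ - m + 1) * (ℓ - m) * Q) := by
          gcongr ?_ * (?_ * _)
          exact mul_le_mul hd1 hd2 (by positivity) (by linarith)
      _ ≤ 100 * ((4 * (m + 1)) ^ 2 * ω * (e + 2) ^ 2) := by linarith
      _ ≤ 100 * ((4 * (3 / 2 * m)) ^ 2 * ω * (2 * e) ^ 2) := by gcongr
      _ = _ := by ring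
  have hYY : 98 / 100 * e ^ 2 ≤ Y ^ 2 := by
    calc 98 / 100 * e ^ 2 ≤ (99 / 100 * e) ^ 2 := by linarith [sq_nonneg e]
      _ ≤ Y ^ 2 := by gcongr
  have hYe : Y ≤ e := by linarith
  have hℓ2 : (0 : ℝ) < ℓ ^ 2 := by positivity
  have hωe2 : ω * e ^ 2 ≤ 1 / 10 ^ 30 * e ^ 2 := by gcongr
  norm_num at hωe2
  have hee : 2 * e ≤ e ^ 2 := by rw [sq]; gcongr
  have hpos : 0 < e ^ 2 := by positivity
  rcases hN' with hN' | hN'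
  · have hQ2 : Q ≤ 14400 * (ω * e ^ 2) := by
      refine le_of_mul_le_mul_left (hQ'.trans ?_) hℓ2
      have : m ^ 2 ≤ ℓ ^ 2 := by gcongr; linarith
      have := mul_le_mul_of_nonneg_right this (by positivity : 0 ≤ 14400 * (ω * e ^ 2))
      linarith
    have : N * (Q + Y) ≤ 1 * (Q + Y) := mul_le_mul_of_nonneg_right hN' (by linarith)
    linarith
  · have hNm : N * m ≤ 20 * ℓ * ω := by
      have : N / 2 * (m / 2) ≤ (N - 1) * (m - 1) := by gcongr <;> linarith
      linarith
    have hN2 : N ≤ 20 * (ω * e) := by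
      have h1 : N * 2 ≤ N * m := by gcongr
      have h2 : ℓ * ω ≤ 2 * e * ω := by gcongr
      linarith
    have hNQ : N * Q ≤ 288000 * ω * (ω * e ^ 2) := by
      refine le_of_mul_le_mul_left ?_ hℓ2
      calc ℓ ^ 2 * (N * Q) = N * (ℓ ^ 2 * Q) := by ring
        _ ≤ N * (14400 * m ^ 2 * ω * e ^ 2) := by gcongr
        _ = (N * m) * m * (14400 * ω * e ^ 2) := by ring
        _ ≤ (20 * ℓ * ω) * ℓ * (14400 * ω * e ^ 2) := by gcongr; linarith
        _ = _ := by ring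
    have hNY : N * Y ≤ 20 * (ω * e ^ 2) := by
      calc N * Y ≤ 20 * (ω * e) * e := by gcongr
        _ = _ := by ring
    have : 288000 * ω * (ω * e ^ 2) ≤ 1 * (ω * e ^ 2) := by
      gcongr
      norm_num at hω
      linarith
    linarith

lemma thin_absurd {ω e D Y Z F ℓ Q : ℝ} (hω0 : 0 < ω) (hω : ω ≤ 1 / 10 ^ 30) (he : 2 ≤ e)
    (hsum : e = D + Y + Z) (hD : 0 ≤ D) (hY : 0 ≤ Y) (hZ : 0 ≤ Z) (hF : 1 ≤ F)
    (hFℓ : F ≤ ℓ) (hℓ : 3 ≤ ℓ) (hℓe : ℓ ≤ 2 * e)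
    (hT : (ℓ - 1) * Z ≤ 4 * ω * (e + 1))
    (hL : F * D ≤ (ℓ + 1) * ω * (Y + Z + 1))
    (hM : (ℓ - F - 1) * Y ≤ 5 * F * ω * (e + 1))
    (hQ : 0 ≤ Q) (hP : (ℓ - 1) * (ℓ - 2) * Q ≤ 64 * ω * (e + 2) ^ 2)
    (hC : Y ^ 2 ≤ ℓ * (Q + Y)) (hW : Q < 1 → Y ^ 2 - Y ≤ 2 * ((ℓ + 1) * ω * (e + 1))) :
    False := by
  have he1 : e + 1 ≤ 3 / 2 * e := by linarith
  have he2 : e + 2 ≤ 2 * e := by linarith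
  have hℓ1 : 2 / 3 * ℓ ≤ ℓ - 1 := by linarith
  have hℓ2 : 1 / 3 * ℓ ≤ ℓ - 2 := by linarith
  have hℓe' : ℓ + 1 ≤ 4 * e := by linarith
  have he0 : 0 < e := by linarith
  have hℓ0 : 0 < ℓ := by linarith
  have hωe : 0 < ω * e := by positivity
  have hFωe : ω * e ≤ F * (ω * e) := le_mul_of_one_le_left hωe.le hF
  have hR : ω * (e + 1) ≤ 3 / 2 * (ω * e) := by nlinarith
  have hZ' : ℓ * Z ≤ 45 * F * (ω * e) := by nlinarith
  have hD' : F * D ≤ 3 * ℓ * ω * (Y + Z + 1) := by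
    calc F * D ≤ (ℓ + 1) * ω * (Y + Z + 1) := by linarith
      _ ≤ (3 * ℓ) * ω * (Y + Z + 1) := by gcongr ?_ * _ * _; linarith
  have hℓF : ℓ ≤ 2 * e * F := by
    have := mul_le_mul_of_nonneg_left (a := 2 * e) (b := 1) (c := F) (by linarith) (by linarith)
    linarith
  have hY' : 99 / 100 * e ≤ Y := by
    refine main_part_large hω0.le hω he hsum hD hY hZ (by linarith) hFℓ hℓF hZ' hD' ?_
    intro h4
    have h1 : ℓ * Y ≤ 2 * (ℓ - F - 1) * Y := by gcongr; linarith
    have h2 : 5 * F * ω * (e + 1) ≤ 5 * F * (3 / 2 * (ω * e)) := by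
      rw [mul_assoc]
      gcongr
    linarith
  have hQ' : ℓ ^ 2 * Q ≤ 1152 * (ω * e ^ 2) := by
    calc ℓ ^ 2 * Q = 9 / 2 * ((2 / 3 * ℓ) * (1 / 3 * ℓ) * Q) := by ring
      _ ≤ 9 / 2 * ((ℓ - 1) * (ℓ - 2) * Q) := by
          gcongr ?_ * (?_ * _)
          exact mul_le_mul hℓ1 hℓ2 (by positivity) (by linarith)
      _ ≤ 9 / 2 * (64 * ω * (e + 2) ^ 2) := by linarith
      _ ≤ 9 / 2 * (64 * ω * (2 * e) ^ 2) := by gcongr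
      _ = _ := by ring
  have hYY : 98 / 100 * e ^ 2 ≤ Y ^ 2 := by
    calc 98 / 100 * e ^ 2 ≤ (99 / 100 * e) ^ 2 := by linarith [sq_nonneg e]
      _ ≤ Y ^ 2 := by gcongr
  have hYe : Y ≤ e := by linarith
  have hωe2 : ω * e ^ 2 ≤ 1 / 10 ^ 30 * e ^ 2 := by gcongr
  norm_num at hωe2
  have hee : 2 * e ≤ e ^ 2 := by rw [sq]; gcongr
  have hpos : 0 < e ^ 2 := by positivity
  have hYℓ : Y ≤ 11 / 10 * ℓ := by
    by_contra! hcon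
    have h1 : ℓ * Y ^ 2 ≤ ℓ * (ℓ * (Q + Y)) := by gcongr
    have h2 : 11 / 10 * (ℓ ^ 2 * Y) ≤ ℓ * Y ^ 2 := by
      have := mul_le_mul_of_nonneg_right hcon.le (by positivity : 0 ≤ ℓ * Y)
      linarith
    have h3 : 3 * Y ^ 2 ≤ ℓ * Y ^ 2 := by gcongr
    linarith
  have hQ1 : Q < 1 := by
    have h1 : e ≤ 2 * ℓ := by linarith
    have h2 : e ^ 2 ≤ (2 * ℓ) ^ 2 := by gcongr
    refine lt_of_mul_lt_mul_left (a := ℓ ^ 2) ?_ (by positivity)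
    have : 0 < ℓ ^ 2 := by positivity
    linarith
  have hW := hW hQ1
  have : 2 * ((ℓ + 1) * ω * (e + 1)) ≤ 12 * (ω * e ^ 2) := by
    calc 2 * ((ℓ + 1) * ω * (e + 1)) ≤ 2 * ((4 * e) * ω * (3 / 2 * e)) := by gcongr
      _ = _ := by ring
  linarith

lemma heavy_absurd {ω e g x ℓ m : ℝ} (hω0 : 0 < ω) (hω : ω ≤ 1 / 10 ^ 30) (he : 2 ≤ e)
    (hsum : e = g + x) (hg : 0 ≤ g) (hx : 0 ≤ x) (hm : 9 * ℓ ≤ 10 * m) (hmℓ : m + 1 ≤ ℓ)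
    (hℓe : ℓ ≤ 2 * e)
    (hlow : (m - 1) * g ≤ (ℓ - m + 3) * ω * (x + 1))
    (htop : (ℓ - m) * x ≤ (ℓ + 1) * ω * (g + 1)) : False := by
  have h1 : ℓ * g ≤ 5 * ω * ((ℓ - m) * x + (ℓ - m)) := by
    have h2 : 8 / 10 * ℓ * g ≤ (m - 1) * g := by gcongr; linarith
    have h3 : (ℓ - m + 3) * ω * (x + 1) ≤ (4 * (ℓ - m)) * ω * (x + 1) := by
      gcongr ?_ * _ * _; linarith
    linarith
  have h4 : (ℓ - m) * x ≤ 2 * ω * ℓ * (g + 1) := by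
    have : (ℓ + 1) * ω * (g + 1) ≤ (2 * ℓ) * ω * (g + 1) := by gcongr ?_ * _ * _; linarith
    linarith
  have h5 : g ≤ 5 * ω * (2 * ω * (g + 1) + 1) := by
    refine le_of_mul_le_mul_left (a := ℓ) ?_ (by linarith)
    have : 5 * ω * ((ℓ - m) * x + (ℓ - m)) ≤ 5 * ω * (2 * ω * ℓ * (g + 1) + ℓ) := by
      gcongr; linarith
    linarith
  have hω1 : ω ≤ 1 / 1000 := hω.trans (by norm_num)
  have h6 : g ≤ 1 / 10 := by
    have : 5 * ω * (2 * ω * (g + 1) + 1) ≤ 5 * (1 / 1000) * (2 * (1 / 1000) * (g + 1) + 1) := by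
      gcongr
    linarith
  have h7 : x ≤ (ℓ - m) * x := by nlinarith
  have h8 : 2 * ω * ℓ * (g + 1) ≤ 2 * (1 / 1000) * (2 * e) * (1 / 10 + 1) := by
    gcongr; linarith
  linarith

lemma Charged.le {ι : Type*} {𝒮 : Finset ι} {N N' : ℝ} {Q : ι → ℝ → Prop}
    (h : Charged 𝒮 N Q) (hN : N ≤ N') : Charged 𝒮 N' Q := by
  obtain ⟨Φ, h0, h1, h2⟩ := h
  exact ⟨Φ, h0, h1.trans hN, h2⟩

lemma cast_tsub_ge (a b : ℕ) : (a : ℝ) - b ≤ ((a - b : ℕ) : ℝ) := by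
  have : (a : ℝ) ≤ ((a - b : ℕ) : ℝ) + b := by exact_mod_cast le_tsub_add
  linarith

lemma sq_sum_le (A : Finset V) (x : V → ℕ) :
    ((∑ v ∈ A, x v : ℕ) : ℝ) ^ 2
      ≤ (#A : ℝ) * ((∑ v ∈ A, x v * (x v - 1) : ℕ) + (∑ v ∈ A, x v : ℕ)) := by
  have h : ∑ v ∈ A, x v * (x v - 1) + ∑ v ∈ A, x v = ∑ v ∈ A, x v ^ 2 := by
    rw [← Finset.sum_add_distrib]
    refine Finset.sum_congr rfl fun v _ => ?_
    rcases x v with _ | n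
    · rfl
    · rw [Nat.add_sub_cancel]
      ring
  have := sq_sum_le_card_mul_sum_sq (s := A) (f := x)
  rw [← h] at this
  exact_mod_cast this

namespace Model

variable {k ℓ : ℕ} {s : ℕ → ℕ} {α w : ℕ} {P : Finset V → Prop}

lemma eq_of_adj_leaf {X : Finset V} {u v v' : V} (hu : u ∈ Lv T X) (hv : v ∈ X) (hv' : v' ∈ X)
    (hvu : T.Adj v u) (hvu' : T.Adj v' u) : v = v' := by
  have h1 : #{w ∈ X | T.Adj u w} = 1 := (mem_Lv.1 hu).2
  exact Finset.card_le_one.1 h1.le _ (Finset.mem_filter.2 ⟨hv, hvu.symm⟩) _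
    (Finset.mem_filter.2 ⟨hv', hvu'.symm⟩)

lemma card_mul_le (h : Model T k ℓ s α w P) {X : Finset V} (hX : P X) {m : ℕ} (hm : 1 ≤ m) :
    #{v ∈ X | lf T X v + 1 = m} * (m - 1) ≤ ℓ - s m := by
  rw [← h.leaves hX, ← h.sj m hX, ← Finset.card_sdiff_of_subset (Sj_subset_Lv m X)]
  rw [← mul_one #(Lv T X \ Sj T m X)]
  refine Finset.card_mul_le_card_mul (fun v u => T.Adj v u) ?_ ?_
  · intro v hv
    obtain ⟨hvX, hvm⟩ := Finset.mem_filter.1 hv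
    have : m - 1 = lf T X v := by omega
    rw [this]
    refine Finset.card_le_card fun u hu => ?_
    obtain ⟨huL, hvu⟩ := Finset.mem_filter.1 hu
    refine (Finset.mem_bipartiteAbove _).2 ⟨Finset.mem_sdiff.2 ⟨huL, fun huS => ?_⟩, hvu⟩
    obtain ⟨-, v', hv', hvu', hm'⟩ := Finset.mem_filter.1 huS
    rw [← eq_of_adj_leaf huL hvX hv' hvu hvu'] at hm'
    omega
  · intro u hu
    refine Finset.card_le_one.2 fun v hv v' hv' => ?_
    obtain ⟨hv, hvu⟩ := (Finset.mem_bipartiteBelow _).1 hv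
    obtain ⟨hv', hvu'⟩ := (Finset.mem_bipartiteBelow _).1 hv'
    exact eq_of_adj_leaf (Finset.mem_sdiff.1 hu).1 (Finset.mem_filter.1 hv).1
      (Finset.mem_filter.1 hv').1 hvu hvu'

lemma sj_le_of_heavy (h : Model T k ℓ s α w P)
    {X : Finset V} (hX : P X) {m : ℕ} (hm : ℓ < 2 * m) (hs : s (m + 1) = 0) :
    s m ≤ m := by
  rw [← h.sj m hX]
  rcases (Sj T m X).eq_empty_or_nonempty with h0 | ⟨u, hu⟩
  · rw [h0]
    exact Nat.zero_le _
  · obtain ⟨-, v, hv, -, hvm⟩ := Finset.mem_filter.1 hu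
    have : Sj T m X ⊆ {u ∈ Lv T X | T.Adj v u} := by
      intro u' hu'
      obtain ⟨hu'L, v', hv', hvu', hvm'⟩ := Finset.mem_filter.1 hu'
      rcases eq_or_ne v v' with rfl | hne
      · exact Finset.mem_filter.2 ⟨hu'L, hvu'⟩
      · have := lf_add_lf_le (T := T) hv hv' hne
        rw [h.leaves hX] at this
        omega
    exact (Finset.card_le_card this).trans (h.lf_le_of_sj_zero hX hs hv)

lemma heavy_false (h : Model T k ℓ s α w P) (hV : k * 10 ^ 36 ≤ Fintype.card V)
    (hbad : (10 : ℝ) ^ 35 * #(bad T k P) < #(subtrees T k)) {X₀ : Finset V} (hX₀ : P X₀) {m : ℕ}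
    (hs : 0 < s m) (hs' : s (m + 1) = 0) (hmℓ : m < ℓ) (hm : 9 * ℓ < 10 * m) : False := by
  have hsm : s m = m := le_antisymm (h.sj_le_of_heavy hX₀ (by omega) hs') (h.le_sj hX₀ hs)
  obtain ⟨X, hX, hℓ, h1, h2⟩ := h.exists_typical hV hbad
    (fun X => monotone_and (monotone_flow _ _ _) (monotone_flow _ _ _)) fun 𝒮 h𝒮 =>
      ((h.charged_heavy_low h𝒮 hm hmℓ hs').and (h.charged_heavy_top h𝒮 (by omega) hs')
        (fun X => monotone_flow _ _ _) fun X => monotone_flow _ _ _).le (by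
          have : (0 : ℝ) ≤ #(bad T k P) := Nat.cast_nonneg _
          linarith)
  have hℓ3 : (3 : ℝ) ≤ ℓ := by exact_mod_cast h.three_le
  have he : (2 : ℝ) ≤ ex T X := by
    have : (1 : ℝ) < ex T X := by linarith
    exact_mod_cast this
  have hsum : ex T X = ∑ v ∈ X with lf T X v < m, xt T X v
      + ∑ v ∈ X with m ≤ lf T X v, xt T X v := by
    rw [ex, ← Finset.sum_filter_add_sum_filter_not X (fun v => lf T X v < m)]
    simp_rw [not_lt]
  set g := ∑ v ∈ X with lf T X v < m, xt T X v
  set x := ∑ v ∈ X with m ≤ lf T X v, xt T X v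
  rw [hsm] at h1 h2
  have hm1 : 1 ≤ m := by omega
  push_cast [Nat.cast_sub hmℓ.le, Nat.cast_sub hm1] at h1 h2
  exact heavy_absurd (ω := 1 / 10 ^ 30) (e := ex T X) (g := g) (x := x) (ℓ := ℓ) (m := m)
    (by positivity) le_rfl he (by exact_mod_cast hsum) (Nat.cast_nonneg _) (Nat.cast_nonneg _)
    (by exact_mod_cast hm.le) (by exact_mod_cast hmℓ) (by linarith) h1 h2

lemma spread_false (h : Model T k ℓ s α w P) (hV : k * 10 ^ 36 ≤ Fintype.card V)
    (hbad : (10 : ℝ) ^ 35 * #(bad T k P) < #(subtrees T k)) {m : ℕ}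
    (hm : 2 ≤ m) (hs : 0 < s m) (hs' : s (m + 1) = 0) (hmℓ : 10 * m ≤ 9 * ℓ) : False := by
  have hA : ∀ X, P X → ∀ v ∈ ({v ∈ X | lf T X v + 1 = m} : Finset V), v ∈ X ∧ m ≤ lf T X v + 1 ∧
      ℓ - (m - 1) ≤ #{u ∈ Lv T X | v ≠ u ∧ ¬ T.Adj v u} := by
    intro X hX v hv
    obtain ⟨hvX, hvm⟩ := Finset.mem_filter.1 hv
    refine ⟨hvX, hvm.ge, ?_⟩
    have hne : ∀ u ∈ Lv T X, v ≠ u := by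
      rintro u hu rfl
      have := h.lf_leaf hX hu
      omega
    rw [Finset.filter_congr (q := fun u => ¬ T.Adj v u) fun u hu => by simp [hne u hu]]
    have h1 := card_filter_not_adj (T := T) (Lv T X) v
    rw [h.leaves hX] at h1
    have h2 : dg T (Lv T X) v + 1 = m := hvm
    omega
  obtain ⟨X, hX, hℓ, h1, h2, h3, h4⟩ := h.exists_typical hV hbad
    (fun X => monotone_and (monotone_flow _ _ _) (monotone_and (monotone_flow _ _ _)
      (monotone_and (monotone_flow _ _ _) (monotone_flow _ _ _)))) fun 𝒮 h𝒮 =>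
      ((h.charged_top h𝒮 (by omega) hs').and ((h.charged_low h𝒮 hm).and
        ((h.charged_mid h𝒮 hm hs).and (h.charged_pairs h𝒮 hs' _ _ hA)
          (fun X => monotone_flow _ _ _) (fun X => monotone_flow _ _ _))
        (fun X => monotone_flow _ _ _) (fun X => monotone_and (monotone_flow _ _ _)
          (monotone_flow _ _ _)))
        (fun X => monotone_flow _ _ _) (fun X => monotone_and (monotone_flow _ _ _)
          (monotone_and (monotone_flow _ _ _) (monotone_flow _ _ _)))).le (by
          have : (0 : ℝ) ≤ #(bad T k P) := Nat.cast_nonneg _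
          linarith)
  have hℓ3 : (3 : ℝ) ≤ ℓ := by exact_mod_cast h.three_le
  have he : (2 : ℝ) ≤ ex T X := by
    have : (1 : ℝ) < ex T X := by linarith
    exact_mod_cast this
  have hsum : ex T X = ∑ v ∈ X with lf T X v + 1 < m, xt T X v
      + ∑ v ∈ X with m ≤ lf T X v + 1, xt T X v := by
    rw [ex, ← Finset.sum_filter_add_sum_filter_not X (fun v => lf T X v + 1 < m)]
    simp_rw [not_lt]
  have hsum' : ∑ v ∈ X with m ≤ lf T X v + 1, xt T X v
      = ∑ v ∈ X with lf T X v + 1 = m, xt T X v + ∑ v ∈ X with m ≤ lf T X v, xt T X v := by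
    rw [← Finset.sum_filter_add_sum_filter_not _ (fun v => lf T X v + 1 = m),
      Finset.filter_filter, Finset.filter_filter]
    congr 2 <;> refine Finset.filter_congr fun v _ => ?_ <;> omega
  have hC := sq_sum_le {v ∈ X | lf T X v + 1 = m} (xt T X)
  have hN := h.card_mul_le hX (m := m) (by omega)
  have hN' : #{v ∈ X | lf T X v + 1 = m} ≤ 1 ∨ 2 ≤ #{v ∈ X | lf T X v + 1 = m} := by omega
  have hmF := h.le_sj hX hs
  have hFℓ := h.sj_le hX m
  rw [hsum'] at h2
  set N := #{v ∈ X | lf T X v + 1 = m}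
  set D := ∑ v ∈ X with lf T X v + 1 < m, xt T X v
  set Y := ∑ v ∈ X with lf T X v + 1 = m, xt T X v
  set Z := ∑ v ∈ X with m ≤ lf T X v, xt T X v
  set Q := ∑ v ∈ X with lf T X v + 1 = m, xt T X v * (xt T X v - 1)
  have hm1 : 1 ≤ m := by omega
  have hM : (ℓ - (m - 1) - 1 : ℕ) = ℓ - m := by omega
  rw [hM] at h4
  have hcast := cast_tsub_ge (ℓ - s m) (m - 1)
  push_cast [Nat.cast_sub (show m ≤ ℓ by omega), Nat.cast_sub hm1, Nat.cast_sub hFℓ,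
    Nat.cast_sub (show m - 1 ≤ ℓ by omega), Nat.cast_sub (show 1 ≤ s m by omega)]
    at h1 h2 h4 hC hcast
  have hN'' : (N : ℝ) * ((m : ℝ) - 1) ≤ (ℓ : ℝ) - s m := by
    rw [← Nat.cast_sub hFℓ, ← Nat.cast_one, ← Nat.cast_sub hm1]
    exact_mod_cast hN
  refine spread_absurd (ω := 1 / 10 ^ 30) (e := ex T X) (D := D) (Y := Y) (Z := Z) (F := s m)
    (ℓ := ℓ) (m := m) (N := N) (Q := Q) (by positivity) le_rfl he ?_ (Nat.cast_nonneg _)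
    (Nat.cast_nonneg _) (Nat.cast_nonneg _) (by exact_mod_cast hm) (by exact_mod_cast hmℓ)
    (by exact_mod_cast hmF) (by exact_mod_cast hFℓ) hℓ3 (by linarith) h1 h2 ?_
    (Nat.cast_nonneg _) ?_ hC hN'' (by exact_mod_cast hN')
  · rw [hsum, hsum']
    push_cast
    ring
  · push_cast at h3
    refine le_trans ?_ h3
    exact mul_le_mul_of_nonneg_right hcast (Nat.cast_nonneg _)
  · convert h4 using 2
    ring

lemma thin_false (h : Model T k ℓ s α w P) (hV : k * 10 ^ 36 ≤ Fintype.card V)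
    (hbad : (10 : ℝ) ^ 35 * #(bad T k P) < #(subtrees T k)) {X₀ : Finset V} (hX₀ : P X₀)
    (hs : s 2 = 0) : False := by
  have hα := h.la_pos hX₀ hs
  have hA : ∀ X, P X → ∀ v ∈ Lv T X, v ∈ X ∧ 1 ≤ lf T X v + 1 ∧
      ℓ - 1 ≤ #{u ∈ Lv T X | v ≠ u ∧ ¬ T.Adj v u} := by
    intro X hX v hv
    refine ⟨(mem_Lv.1 hv).1, by omega, ?_⟩
    rw [← h.leaves hX, ← Finset.card_erase_of_mem hv]
    refine Finset.card_le_card fun u hu => ?_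
    obtain ⟨hne, hu⟩ := Finset.mem_erase.1 hu
    exact Finset.mem_filter.2 ⟨hu, hne.symm, h.not_adj_leaf hX hv hu⟩
  obtain ⟨X, hX, hℓ, h1, h2, h3, h4, h5⟩ := h.exists_typical hV hbad
    (fun X => monotone_and (monotone_flow _ _ _) (monotone_and (monotone_flow _ _ _)
      (monotone_and (monotone_flow _ _ _) (monotone_and (monotone_flow _ _ _)
        (monotone_flow _ _ _))))) fun 𝒮 h𝒮 =>
      ((h.charged_top h𝒮 le_rfl hs).and ((h.charged_low_one h𝒮).and
        ((h.charged_mid_one h𝒮 hα).and ((h.charged_pairs h𝒮 hs _ _ hA).and (h.charged_wiener h𝒮)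
            (fun X => monotone_flow _ _ _) (fun X => monotone_flow _ _ _))
          (fun X => monotone_flow _ _ _) (fun X => monotone_and (monotone_flow _ _ _)
            (monotone_flow _ _ _)))
        (fun X => monotone_flow _ _ _) (fun X => monotone_and (monotone_flow _ _ _)
          (monotone_and (monotone_flow _ _ _) (monotone_flow _ _ _))))
        (fun X => monotone_flow _ _ _) (fun X => monotone_and (monotone_flow _ _ _)
          (monotone_and (monotone_flow _ _ _) (monotone_and (monotone_flow _ _ _)
            (monotone_flow _ _ _))))).le (by
          have : (0 : ℝ) ≤ #(bad T k P) := Nat.cast_nonneg _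
          linarith)
  have hℓ3 : (3 : ℝ) ≤ ℓ := by exact_mod_cast h.three_le
  have he : (2 : ℝ) ≤ ex T X := by
    have : (1 : ℝ) < ex T X := by linarith
    exact_mod_cast this
  have hsum : ex T X = ∑ v ∈ X with v ∉ Lv T X ∧ lf T X v = 0, xt T X v
      + ∑ v ∈ X with v ∈ Lv T X ∨ 1 ≤ lf T X v, xt T X v := by
    rw [ex, ← Finset.sum_filter_add_sum_filter_not X (fun v => v ∉ Lv T X ∧ lf T X v = 0)]
    congr 2
    refine Finset.filter_congr fun v _ => ?_
    rw [not_and_or, not_not, Nat.one_le_iff_ne_zero]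
  have hsum' : ∑ v ∈ X with v ∈ Lv T X ∨ 1 ≤ lf T X v, xt T X v
      = ∑ v ∈ Lv T X, xt T X v + ∑ v ∈ X with 1 ≤ lf T X v, xt T X v := by
    rw [← Finset.sum_union]
    · refine Finset.sum_congr ?_ fun _ _ => rfl
      ext v
      simp only [Finset.mem_filter, Finset.mem_union]
      have : v ∈ Lv T X → v ∈ X := fun hv => (mem_Lv.1 hv).1
      tauto
    · refine Finset.disjoint_left.2 fun v hv hv' => ?_
      have h1 := (Finset.mem_filter.1 hv').2
      rw [h.lf_leaf hX hv] at h1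
      omega
  have hC := sq_sum_le (Lv T X) (xt T X)
  have hFℓ : α ≤ ℓ := by
    rw [← h.la hX, ← h.leaves hX]
    exact Finset.card_le_card (La_subset_Lv X)
  have hW : ∑ v ∈ Lv T X, xt T X v * (xt T X v - 1) < 1 →
      #{v ∈ Lv T X | 1 ≤ xt T X v} = ∑ v ∈ Lv T X, xt T X v := by
    intro h0
    rw [Finset.card_filter]
    refine Finset.sum_congr rfl fun v hv => ?_
    have h0 := (Finset.sum_eq_zero_iff.1 (Nat.lt_one_iff.1 h0)) v hv
    rcases Nat.mul_eq_zero.1 h0 with h0 | h0 <;> split_ifs <;> omega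
  rw [h.leaves hX] at hC
  rw [hsum'] at h2
  set D := ∑ v ∈ X with v ∉ Lv T X ∧ lf T X v = 0, xt T X v
  set Y := ∑ v ∈ Lv T X, xt T X v
  set Z := ∑ v ∈ X with 1 ≤ lf T X v, xt T X v
  set Q := ∑ v ∈ Lv T X, xt T X v * (xt T X v - 1)
  have h3ℓ := h.three_le
  have hcast := cast_tsub_ge (ℓ - α) 1
  have hM : ℓ - 1 - 1 = ℓ - 2 := by omega
  rw [hM] at h4
  push_cast [Nat.cast_sub (show 1 ≤ ℓ by omega), Nat.cast_sub hFℓ,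
    Nat.cast_sub (show 2 ≤ ℓ by omega)] at h1 h2 h4 hC hcast
  refine thin_absurd (ω := 1 / 10 ^ 30) (e := ex T X) (D := D) (Y := Y) (Z := Z) (F := α)
    (ℓ := ℓ) (Q := Q) (by positivity) le_rfl he ?_ (Nat.cast_nonneg _)
    (Nat.cast_nonneg _) (Nat.cast_nonneg _) (by exact_mod_cast hα) (by exact_mod_cast hFℓ) hℓ3
    (by linarith) (by linarith) h2 ?_ (Nat.cast_nonneg _) (by linarith) hC ?_
  · rw [hsum, hsum']
    push_cast
    ring
  · push_cast at h3
    refine le_trans ?_ h3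
    exact mul_le_mul_of_nonneg_right hcast (Nat.cast_nonneg _)
  · intro hQ
    have hQ' := hW (by exact_mod_cast hQ)
    rw [Finset.offDiag_card, hQ'] at h5
    have heven : (Y * Y - Y) / 2 * 2 = Y * Y - Y := by
      rw [← Nat.mul_sub_one]
      exact Nat.div_mul_cancel (Nat.even_mul_pred_self Y).two_dvd
    have h6 := cast_tsub_ge (Y * Y) Y
    rw [← heven] at h6
    push_cast at h5 h6
    linarith

/-- At least a `10⁻³⁵` fraction of all subtrees violates `P`. -/
theorem card_subtrees_le (h : Model T k ℓ s α w P) (hV : k * 10 ^ 36 ≤ Fintype.card V) :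
    (#(subtrees T k) : ℝ) ≤ 10 ^ 35 * #(bad T k P) := by
  by_contra! hbad
  obtain ⟨X₀, hX₀⟩ : ∃ X, P X := by
    by_contra! hP
    have : subtrees T k = bad T k P := by
      ext X
      simp [subtrees, bad, hP X]
    rw [this] at hbad
    have : (0 : ℝ) ≤ #(bad T k P) := Nat.cast_nonneg _
    linarith
  obtain ⟨m, hm, hs, hs', hmℓ⟩ := h.exists_max hX₀
  by_cases h9 : 9 * ℓ < 10 * m
  · exact h.heavy_false hV hbad hX₀ hs hs' hmℓ h9
  · rcases hm.eq_or_lt with rfl | hm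
    · exact h.thin_false hV hbad hX₀ hs'
    · exact h.spread_false hV hbad hm hs hs' (not_lt.1 h9)

end Model

lemma density_le {W : Type*} [Fintype W] {S : SimpleGraph W} (hS : S.IsTree) {k : ℕ}
    (hk : Fintype.card W = k)
    (hle : (#(subtrees T k) : ℝ)
      ≤ 10 ^ 35 * #(bad T k fun X => Nonempty (T.induce (X : Set V) ≃g S))) :
    density S T ≤ 1 - (1 / 10) ^ 35 := by
  have h1 : subtreeCount T k = #(subtrees T k) := by
    rw [subtreeCount, ← Set.ncard_coe_finset (subtrees T k)]
    congr 1
    ext X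
    rw [Finset.mem_coe, subtrees, Finset.mem_filter]
    exact ⟨fun hX => ⟨Finset.mem_univ _, hX⟩, And.right⟩
  have h2 : embCount T S k + #(bad T k fun X => Nonempty (T.induce (X : Set V) ≃g S))
      = #(subtrees T k) := by
    have h3 : embCount T S k
        = #((subtrees T k).filter fun X : Finset V => Nonempty (T.induce (X : Set V) ≃g S)) := by
      rw [embCount, ← Set.ncard_coe_finset (Finset.filter _ (subtrees T k))]
      congr 1
      ext X
      simp only [subtrees, Finset.coe_filter, Finset.mem_filter, Finset.mem_univ, true_and,
        Set.mem_ofPred_eq]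
      constructor
      · rintro ⟨h4, ⟨φ⟩⟩
        exact ⟨⟨h4, φ.connected_iff.2 hS.1⟩, ⟨φ⟩⟩
      · rintro ⟨⟨h4, -⟩, h5⟩
        exact ⟨h4, h5⟩
    rw [h3, ← Finset.card_filter_add_card_filter_not
      (s := subtrees T k) (fun X : Finset V => Nonempty (T.induce (X : Set V) ≃g S))]
    congr 2
    ext X
    simp [subtrees, bad, and_assoc]
  rw [density, hk, h1]
  refine div_le_of_le_mul₀ (Nat.cast_nonneg _) (by norm_num) ?_
  have h2' : (embCount T S k : ℝ) + #(bad T k fun X => Nonempty (T.induce (X : Set V) ≃g S))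
      = #(subtrees T k) := by exact_mod_cast h2
  norm_num at hle ⊢
  linarith

end TreeDensity

/-- Every finite tree that is neither a star nor a path has inducibility
at most 1 - 10^(-35). -/
theorem inducibility_le_of_not_star_not_path {W : Type*} [Fintype W]
    (S : SimpleGraph W) (hS : S.IsTree)
    (hstar : ¬ IsStarlike S) (hpath : ¬ IsPathlike S) :
    inducibility S ≤ 1 - (1 / 10 : ℝ) ^ 35 := by
  obtain ⟨ℓ, s, α, w, hmodel⟩ := TreeDensity.exists_model hS hstar hpath
  have h0 : ∀ n, 0 ≤ maxDensity S n := fun n =>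
    Real.sSup_nonneg (by
      rintro x ⟨T, -, rfl⟩
      exact div_nonneg (Nat.cast_nonneg _) (Nat.cast_nonneg _))
  refine Filter.limsup_le_of_le
    (Filter.IsBoundedUnder.isCoboundedUnder_le ⟨0, by simpa using ⟨0, fun n _ => h0 n⟩⟩) ?_
  filter_upwards [Filter.eventually_ge_atTop (Fintype.card W * 10 ^ 36)] with n hn
  refine Real.sSup_le ?_ (by norm_num)
  rintro x ⟨T, hT, rfl⟩
  exact TreeDensity.density_le hS rfl
    ((hmodel T hT).card_subtrees_le (by rwa [Fintype.card_fin]))
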